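/- arXiv:2504.11387 — 6 statements merged into one kernel-verified Lean document; each statement's English description precedes it below -/
import Mathlib

section
/- Let λ, c > 0 and t > 0, and let γ be a real number with |γ| < λ/c. Then ∫₀^{ct} e^{iγx} I₀((λ/c)√(c²t²−x²)) dx = c·sinh(t√(λ²−c²γ²))/√(λ²−c²γ²) + i c²γ ∫₀^{t} ( sinh(s√(λ²−c²γ²))/√(λ²−c²γ²) ) I₀(λ(t−s)) ds. -/
open Real intervalIntegral

/-- Modified Bessel function of the first kind,
`I_ν(x) = ∑_{k≥0} (x/2)^{2k+ν} / (k! Γ(ν+k+1))`. -/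
noncomputable def besselI (ν x : ℝ) : ℝ :=
  ∑' k : ℕ, (x / 2) ^ (2 * (k : ℝ) + ν) / ((k.factorial : ℝ) * Real.Gamma (ν + k + 1))

open Set Filter Topology MeasureTheory

/-- The entire function `r ↦ ∑ r ^ k / (k! (k + m)!)`; one has `I_0 (x) = besselSeries 0 (x ^ 2 / 4)`. -/
noncomputable def besselSeries (m : ℕ) (r : ℝ) : ℝ :=
  ∑' k : ℕ, r ^ k / ((k.factorial : ℝ) * ((k + m).factorial : ℝ))

lemma norm_besselSeries_term_le (m k : ℕ) {r R : ℝ} (h : |r| ≤ R) :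
    ‖r ^ k / ((k.factorial : ℝ) * ((k + m).factorial : ℝ))‖ ≤ R ^ k / (k.factorial : ℝ) := by
  have h1 : (1 : ℝ) ≤ ((k + m).factorial : ℝ) := by
    exact_mod_cast Nat.one_le_iff_ne_zero.2 (Nat.factorial_ne_zero _)
  have h2 : (0 : ℝ) < (k.factorial : ℝ) := by positivity
  rw [norm_div, norm_pow, Real.norm_eq_abs, norm_mul, Real.norm_natCast, Real.norm_natCast]
  have hR : 0 ≤ R := (abs_nonneg r).trans h
  gcongr
  nlinarith

lemma summable_besselSeries (m : ℕ) (r : ℝ) :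
    Summable fun k : ℕ => r ^ k / ((k.factorial : ℝ) * ((k + m).factorial : ℝ)) :=
  .of_norm_bounded (Real.summable_pow_div_factorial |r|)
    fun k => norm_besselSeries_term_le m k le_rfl

lemma hasDerivAt_besselSeries (m : ℕ) (r : ℝ) :
    HasDerivAt (besselSeries m) (besselSeries (m + 1) r) r := by
  set R := |r| + 1
  have hrR : r ∈ Metric.ball (0 : ℝ) R := by simp [R]
  have key : ∀ k : ℕ, ∀ y : ℝ,
      HasDerivAt (fun y : ℝ => y ^ (k + 1) / (((k + 1).factorial : ℝ) * ((k + 1 + m).factorial : ℝ)))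
        (y ^ k / ((k.factorial : ℝ) * ((k + (m + 1)).factorial : ℝ))) y := by
    intro k y
    refine ((hasDerivAt_pow (k + 1) y).div_const _).congr_deriv ?_
    rw [show k + 1 + m = k + (m + 1) by ring, Nat.factorial_succ k]
    push_cast
    field_simp
  have h := hasDerivAt_tsum_of_isPreconnected (Real.summable_pow_div_factorial R)
    Metric.isOpen_ball (convex_ball (0 : ℝ) R).isPreconnected (fun k y _ => key k y)
    (fun k y hy => norm_besselSeries_term_le (m + 1) k (by simpa using (Metric.mem_ball.1 hy).le)) hrR
    ((summable_nat_add_iff 1).2 (summable_besselSeries m r)) hrR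
  have h' := h.const_add (1 / (m.factorial : ℝ))
  refine h'.congr_of_eventuallyEq (Eventually.of_forall fun y => ?_)
  rw [besselSeries, (summable_besselSeries m y).tsum_eq_zero_add]
  simp

lemma continuous_besselSeries (m : ℕ) : Continuous (besselSeries m) :=
  continuous_iff_continuousAt.2 fun r => (hasDerivAt_besselSeries m r).continuousAt

lemma mul_besselSeries_two_add (r : ℝ) :
    r * besselSeries 2 r + besselSeries 1 r = besselSeries 0 r := by
  have h : r * besselSeries 2 r
      = ∑' k : ℕ, (k : ℝ) * (r ^ k / ((k.factorial : ℝ) * ((k + 1).factorial : ℝ))) := by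
    have hs : ∀ k : ℕ, ((k + 1 : ℕ) : ℝ) *
          (r ^ (k + 1) / (((k + 1).factorial : ℝ) * ((k + 1 + 1).factorial : ℝ)))
        = r * (r ^ k / ((k.factorial : ℝ) * ((k + 2).factorial : ℝ))) := by
      intro k
      rw [Nat.factorial_succ k]
      push_cast
      field_simp
      ring
    rw [Summable.tsum_eq_zero_add]
    · simp only [hs, tsum_mul_left]
      simp [besselSeries]
    · refine (summable_nat_add_iff 1).1 ?_
      simp only [hs]
      exact (summable_besselSeries 2 r).mul_left r
  have hsum : Summable fun k : ℕ =>
      (k : ℝ) * (r ^ k / ((k.factorial : ℝ) * ((k + 1).factorial : ℝ))) := by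
    refine ((summable_besselSeries 0 r).sub (summable_besselSeries 1 r)).congr fun k => ?_
    rw [Nat.factorial_succ k, add_zero]
    push_cast
    field_simp
    ring
  rw [h, besselSeries, ← hsum.tsum_add (summable_besselSeries 1 r), besselSeries]
  refine tsum_congr fun k => ?_
  rw [Nat.factorial_succ k, add_zero]
  push_cast
  field_simp

lemma besselI_zero_eq (x : ℝ) : besselI 0 x = besselSeries 0 (x ^ 2 / 4) := by
  refine tsum_congr fun k => ?_
  rw [zero_add, Real.Gamma_nat_eq_factorial, add_zero, add_zero,
    show (2 * (k : ℝ)) = ((2 * k : ℕ) : ℝ) by push_cast; ring, Real.rpow_natCast, pow_mul]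
  ring

/-- Leibniz rule for an integral whose upper endpoint is the parameter. -/
lemma hasDerivAt_integral_zero_self {f f' : ℝ → ℝ → ℂ} (hf : Continuous (Function.uncurry f))
    (hf' : Continuous (Function.uncurry f'))
    (hd : ∀ t y, HasDerivAt (fun s => f s y) (f' t y) t) (t : ℝ) :
    HasDerivAt (fun s => ∫ y in (0 : ℝ)..s, f s y) (f t t + ∫ y in (0 : ℝ)..t, f' t y) t := by
  have hint : ∀ s a b, IntervalIntegrable (f s) volume a b := fun s a b =>
    (hf.comp (Continuous.prodMk_right s)).intervalIntegrable a b
  have h1 : HasDerivAt (fun s => ∫ y in t..s, f s y) (f t t) t := by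
    rw [hasDerivAt_iff_isLittleO, Asymptotics.isLittleO_iff]
    intro ε hε
    obtain ⟨δ, hδ, hball⟩ := Metric.continuous_iff.1 hf (t, t) ε hε
    filter_upwards [Metric.ball_mem_nhds t hδ] with x hx
    have hx' : |x - t| < δ := by simpa [Real.dist_eq] using hx
    have e : (∫ y in t..x, f x y) - (∫ y in t..t, f t y) - (x - t) • f t t
        = ∫ y in t..x, (f x y - f t t) := by
      rw [intervalIntegral.integral_sub (hint x t x) (by simp)]
      simp
    rw [e, Real.norm_eq_abs]
    refine intervalIntegral.norm_integral_le_of_norm_le_const fun y hy => ?_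
    have hy' : |y - t| ≤ |x - t| := abs_sub_left_of_mem_uIcc (uIoc_subset_uIcc hy)
    have := hball (x, y) (by
      rw [Prod.dist_eq, Real.dist_eq, Real.dist_eq]
      exact max_lt hx' (hy'.trans_lt hx'))
    rw [dist_eq_norm] at this
    exact this.le
  have h2 : HasDerivAt (fun s => ∫ y in (0 : ℝ)..t, f s y) (∫ y in (0 : ℝ)..t, f' t y) t := by
    obtain ⟨C, hC⟩ := ((isCompact_closedBall t 1).prod
      (isCompact_uIcc (a := (0 : ℝ)) (b := t))).exists_bound_of_continuousOn hf'.continuousOn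
    refine (intervalIntegral.hasDerivAt_integral_of_dominated_loc_of_deriv_le
      (bound := fun _ => C) (Metric.closedBall_mem_nhds t one_pos)
      (Eventually.of_forall fun s =>
        (hf.comp (Continuous.prodMk_right s)).aestronglyMeasurable)
      (hint t 0 t) (hf'.comp (Continuous.prodMk_right t)).aestronglyMeasurable
      (Eventually.of_forall fun y hy s hs => hC (s, y) ⟨hs, uIoc_subset_uIcc hy⟩)
      (by simp) (Eventually.of_forall fun y _ s _ => hd s y)).2
  refine (h1.add h2).congr_of_eventuallyEq (Eventually.of_forall fun s => ?_)
  rw [Pi.add_apply, add_comm, intervalIntegral.integral_add_adjacent_intervals (hint s _ _) (hint s _ _)]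

/-- Duhamel's formula for `F'' = μ² F + h`, `F 0 = 0`, `F' 0 = 1`. -/
lemma eq_sinh_add_integral_of_hasDerivAt {F F' h : ℝ → ℂ} {μ : ℝ} (hμ : μ ≠ 0)
    (hh : Continuous h) (hF : ∀ s, HasDerivAt F (F' s) s)
    (hF' : ∀ s, HasDerivAt F' (μ ^ 2 * F s + h s) s) (h0 : F 0 = 0) (h1 : F' 0 = 1) (t : ℝ) :
    F t = ((Real.sinh (t * μ) / μ : ℝ) : ℂ)
      + ∫ s in (0 : ℝ)..t, ((Real.sinh (s * μ) / μ : ℝ) : ℂ) * h (t - s) := by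
  have hlin : ∀ s : ℝ, HasDerivAt (fun s : ℝ => (t - s) * μ) (-μ) s := fun s => by
    simpa using ((hasDerivAt_id s).const_sub t).mul_const μ
  have hd : ∀ s ∈ uIcc 0 t, HasDerivAt
      (fun s => ((Real.sinh ((t - s) * μ) / μ : ℝ) : ℂ) * F' s
        + ((Real.cosh ((t - s) * μ) : ℝ) : ℂ) * F s)
      (((Real.sinh ((t - s) * μ) / μ : ℝ) : ℂ) * h s) s := by
    intro s _
    have a := ((hlin s).sinh.div_const μ).ofReal_comp.mul (hF' s)
    have b := (hlin s).cosh.ofReal_comp.mul (hF s)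
    refine (a.add b).congr_deriv ?_
    have : (μ : ℂ) ≠ 0 := by exact_mod_cast hμ
    push_cast
    field_simp
    ring
  have hI := intervalIntegral.integral_eq_sub_of_hasDerivAt hd
    (Continuous.intervalIntegrable (by fun_prop) _ _)
  have hsub := intervalIntegral.integral_comp_sub_left (a := 0) (b := t)
    (fun s => ((Real.sinh ((t - s) * μ) / μ : ℝ) : ℂ) * h s) t
  simp only [sub_sub_cancel, sub_self, sub_zero] at hsub
  rw [hsub, hI, h0, h1]
  simp

/-- The truncated Fourier transform of the Klein–Gordon kernel, in unit propagation speed. -/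
lemma integral_exp_mul_besselSeries (a g μ t : ℝ) (hμ : μ ≠ 0) (hμ2 : μ ^ 2 = 4 * a - g ^ 2) :
    ∫ y in (0 : ℝ)..t, Complex.exp (Complex.I * g * y) * (besselSeries 0 (a * (t ^ 2 - y ^ 2)) : ℂ)
      = ((Real.sinh (t * μ) / μ : ℝ) : ℂ)
        + ∫ s in (0 : ℝ)..t, ((Real.sinh (s * μ) / μ : ℝ) : ℂ)
          * (Complex.I * g * (besselSeries 0 (a * (t - s) ^ 2) : ℂ)) := by
  have hc0 := continuous_besselSeries 0
  have hc1 := continuous_besselSeries 1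
  have hc2 := continuous_besselSeries 2
  have hrt : ∀ t y : ℝ, HasDerivAt (fun s : ℝ => a * (s ^ 2 - y ^ 2)) (2 * a * t) t := fun t y => by
    refine ((((hasDerivAt_pow 2 t).sub_const (y ^ 2)).const_mul a)).congr_deriv ?_
    push_cast; ring
  have hry : ∀ t y : ℝ, HasDerivAt (fun s : ℝ => a * (t ^ 2 - s ^ 2)) (-(2 * a * y)) y :=
    fun t y => by
      refine ((((hasDerivAt_pow 2 y).const_sub (t ^ 2)).const_mul a)).congr_deriv ?_
      push_cast; ring
  have hBt : ∀ m (t y : ℝ), HasDerivAt (fun s : ℝ => besselSeries m (a * (s ^ 2 - y ^ 2)))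
      (besselSeries (m + 1) (a * (t ^ 2 - y ^ 2)) * (2 * a * t)) t := fun m t y =>
    (hasDerivAt_besselSeries m _).comp t (hrt t y)
  have hBy : ∀ m (t y : ℝ), HasDerivAt (fun s : ℝ => besselSeries m (a * (t ^ 2 - s ^ 2)))
      (besselSeries (m + 1) (a * (t ^ 2 - y ^ 2)) * (-(2 * a * y))) y := fun m t y =>
    (hasDerivAt_besselSeries m _).comp y (hry t y)
  set E : ℝ → ℂ := fun y => Complex.exp (Complex.I * g * y) with hE
  have hEc : Continuous E := by fun_prop
  have hEd : ∀ y, HasDerivAt E (E y * (Complex.I * g)) y := fun y => by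
    have := ((Complex.ofRealCLM.hasDerivAt (x := y)).const_mul (Complex.I * g)).cexp
    simpa [hE] using this
  set v : ℝ → ℝ → ℝ := fun t y => besselSeries 0 (a * (t ^ 2 - y ^ 2)) with hv
  set vt : ℝ → ℝ → ℝ := fun t y => besselSeries 1 (a * (t ^ 2 - y ^ 2)) * (2 * a * t) with hvt
  set vtt : ℝ → ℝ → ℝ := fun t y => besselSeries 2 (a * (t ^ 2 - y ^ 2)) * (2 * a * t) * (2 * a * t)
    + besselSeries 1 (a * (t ^ 2 - y ^ 2)) * (2 * a) with hvtt
  set vy : ℝ → ℝ → ℝ := fun t y => besselSeries 1 (a * (t ^ 2 - y ^ 2)) * (-(2 * a * y)) with hvy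
  have hdvt : ∀ t y, HasDerivAt (fun s => vt s y) (vtt t y) t := fun t y => by
    refine ((hBt 1 t y).mul ((hasDerivAt_id t).const_mul (2 * a))).congr_deriv ?_
    simp [hvtt]
  have hdvy : ∀ t y, HasDerivAt (fun s => vy t s) (vtt t y - 4 * a * v t y) y := fun t y => by
    refine ((hBy 1 t y).mul (((hasDerivAt_id y).const_mul (2 * a)).neg)).congr_deriv ?_
    simp only [hvtt, hv, ← mul_besselSeries_two_add (a * (t ^ 2 - y ^ 2)), Pi.neg_apply, id]
    ring
  set F : ℝ → ℂ := fun t => ∫ y in (0 : ℝ)..t, E y * (v t y : ℂ) with hFdef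
  set F' : ℝ → ℂ := fun t => E t + ∫ y in (0 : ℝ)..t, E y * (vt t y : ℂ) with hF'def
  have hB0 : besselSeries 0 0 = 1 := by
    rw [besselSeries, tsum_eq_single 0]
    · simp
    · intro k hk; simp [hk]
  have hF : ∀ s, HasDerivAt F (F' s) s := fun s => by
    have := hasDerivAt_integral_zero_self (f := fun t y => E y * (v t y : ℂ))
      (f' := fun t y => E y * (vt t y : ℂ)) (by simp only [hv]; fun_prop)
      (by simp only [hvt]; fun_prop) (fun t y => (hBt 0 t y).ofReal_comp.const_mul _) s
    simpa [hv, hB0] using this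
  have hF' : ∀ s, HasDerivAt F' ((μ : ℂ) ^ 2 * F s
      + Complex.I * g * (besselSeries 0 (a * s ^ 2) : ℂ)) s := fun s => by
    have h1 := (hEd s).add (hasDerivAt_integral_zero_self (f := fun t y => E y * (vt t y : ℂ))
      (f' := fun t y => E y * (vtt t y : ℂ)) (by simp only [hvt]; fun_prop)
      (by simp only [hvtt]; fun_prop) (fun t y => (hdvt t y).ofReal_comp.const_mul _) s)
    refine h1.congr_deriv ?_
    have hd : ∀ y ∈ uIcc 0 s, HasDerivAt
        (fun y => E y * (vy s y : ℂ) - E y * (Complex.I * g) * (v s y : ℂ))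
        (E y * (vtt s y : ℂ) - (μ : ℂ) ^ 2 * (E y * (v s y : ℂ))) y := fun y _ => by
      refine (((hEd y).mul (hdvy s y).ofReal_comp).sub
        (((hEd y).mul_const (Complex.I * g)).mul (hBy 0 s y).ofReal_comp)).congr_deriv ?_
      have hμ3 : (μ : ℂ) ^ 2 = 4 * a - g ^ 2 := by exact_mod_cast hμ2
      rw [hμ3]
      simp only [hv, hvy]
      push_cast
      linear_combination (-(E y) * g ^ 2 * (besselSeries 0 (a * (s ^ 2 - y ^ 2)) : ℂ)) * Complex.I_sq
    have hi1 : IntervalIntegrable (fun y => E y * (vtt s y : ℂ)) volume 0 s :=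
      Continuous.intervalIntegrable (by simp only [hvtt]; fun_prop) _ _
    have hi2 : IntervalIntegrable (fun y => (μ : ℂ) ^ 2 * (E y * (v s y : ℂ))) volume 0 s :=
      Continuous.intervalIntegrable (by simp only [hv]; fun_prop) _ _
    have hI := intervalIntegral.integral_eq_sub_of_hasDerivAt hd (hi1.sub hi2)
    rw [intervalIntegral.integral_sub hi1 hi2, intervalIntegral.integral_const_mul,
      sub_eq_iff_eq_add] at hI
    have hE0 : E 0 = 1 := by simp [hE]
    have h00 : v s s = 1 := by simp [hv, hB0]
    have h01 : vy s s = - vt s s := by simp [hvy, hvt]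
    have h02 : vy s 0 = 0 := by simp [hvy]
    have h03 : v s 0 = besselSeries 0 (a * s ^ 2) := by simp [hv]
    rw [hI, hE0, h00, h01, h02, h03]
    simp only [hFdef]
    push_cast
    ring
  exact eq_sinh_add_integral_of_hasDerivAt hμ (by fun_prop) hF hF' (by simp [hFdef])
    (by simp [hF'def, hE]) t

theorem stmt_0 (lam c t γ : ℝ) (hlam : 0 < lam) (hc : 0 < c) (ht : 0 < t)
    (hγ : |γ| < lam / c) :
    ∫ x in (0:ℝ)..(c * t),
        Complex.exp (Complex.I * γ * x) *
          (besselI 0 (lam / c * Real.sqrt (c ^ 2 * t ^ 2 - x ^ 2)) : ℂ)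
      = ((c * Real.sinh (t * Real.sqrt (lam ^ 2 - c ^ 2 * γ ^ 2))
            / Real.sqrt (lam ^ 2 - c ^ 2 * γ ^ 2) : ℝ) : ℂ)
        + Complex.I * (c : ℂ) ^ 2 * (γ : ℂ) *
          ((∫ s in (0:ℝ)..t,
              Real.sinh (s * Real.sqrt (lam ^ 2 - c ^ 2 * γ ^ 2))
                / Real.sqrt (lam ^ 2 - c ^ 2 * γ ^ 2)
                * besselI 0 (lam * (t - s)) : ℝ) : ℂ) := by
  have hgl : |c * γ| < lam := by
    rw [abs_mul, abs_of_pos hc, mul_comm]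
    exact (lt_div_iff₀ hc).1 hγ
  have hpos : 0 < lam ^ 2 - c ^ 2 * γ ^ 2 := by
    have := sq_lt_sq' (neg_lt_of_abs_lt hgl) (lt_of_abs_lt hgl)
    linarith [mul_pow c γ 2]
  set μ := Real.sqrt (lam ^ 2 - c ^ 2 * γ ^ 2) with hμdef
  have hμ : μ ≠ 0 := (Real.sqrt_pos.2 hpos).ne'
  have hμ2 : μ ^ 2 = 4 * (lam ^ 2 / 4) - (c * γ) ^ 2 := by
    rw [hμdef, Real.sq_sqrt hpos.le]
    ring
  have key := integral_exp_mul_besselSeries (lam ^ 2 / 4) (c * γ) μ t hμ hμ2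
  have hscale := intervalIntegral.smul_integral_comp_mul_left (a := 0) (b := t)
    (fun x : ℝ => Complex.exp (Complex.I * γ * x) *
      (besselI 0 (lam / c * Real.sqrt (c ^ 2 * t ^ 2 - x ^ 2)) : ℂ)) c
  rw [mul_zero] at hscale
  have hl : ∫ x in (0 : ℝ)..t, Complex.exp (Complex.I * γ * (c * x : ℝ)) *
      (besselI 0 (lam / c * Real.sqrt (c ^ 2 * t ^ 2 - (c * x) ^ 2)) : ℂ)
      = ∫ y in (0 : ℝ)..t, Complex.exp (Complex.I * (c * γ : ℝ) * y) *
        (besselSeries 0 (lam ^ 2 / 4 * (t ^ 2 - y ^ 2)) : ℂ) := by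
    refine intervalIntegral.integral_congr fun y hy => ?_
    rw [uIcc_of_le ht.le] at hy
    have hnn : 0 ≤ c ^ 2 * t ^ 2 - (c * y) ^ 2 := by
      have := pow_le_pow_left₀ hy.1 hy.2 2
      nlinarith [sq_nonneg c]
    have harg : (lam / c * Real.sqrt (c ^ 2 * t ^ 2 - (c * y) ^ 2)) ^ 2 / 4
        = lam ^ 2 / 4 * (t ^ 2 - y ^ 2) := by
      rw [mul_pow, Real.sq_sqrt hnn]
      field_simp
    simp only [besselI_zero_eq, harg]
    congr 2
    push_cast
    ring
  have hr : ∫ s in (0 : ℝ)..t, ((Real.sinh (s * μ) / μ : ℝ) : ℂ)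
        * (Complex.I * (c * γ : ℝ) * (besselSeries 0 (lam ^ 2 / 4 * (t - s) ^ 2) : ℂ))
      = Complex.I * (c * γ : ℝ) * ((∫ s in (0 : ℝ)..t,
          Real.sinh (s * μ) / μ * besselI 0 (lam * (t - s)) : ℝ) : ℂ) := by
    rw [← intervalIntegral.integral_ofReal, ← intervalIntegral.integral_const_mul]
    refine intervalIntegral.integral_congr fun s _ => ?_
    simp only [besselI_zero_eq, mul_pow, mul_div_right_comm]
    push_cast
    ring
  rw [← hscale, hl, key, hr, Complex.real_smul]
  push_cast
  ring
end

section
/- Let λ, c > 0 and t > 0, and let γ be a real number with |γ| < λ/c. Then ∫₀^{ct} cos(γx) I₀((λ/c)√(c²t²−x²)) dx = c·sinh(t√(λ²−c²γ²))/√(λ²−c²γ²). -/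
open Real intervalIntegral

lemma besselI_zero_eq_tsum (z : ℝ) :
    besselI 0 z = ∑' k : ℕ, (z ^ 2 / 4) ^ k / ((k.factorial : ℝ) * k.factorial) := by
  unfold besselI
  refine tsum_congr fun k => ?_
  have hexp : (2 * (k : ℝ) + 0) = ((2 * k : ℕ) : ℝ) := by push_cast; ring
  rw [hexp, Real.rpow_natCast, zero_add, Real.Gamma_nat_eq_factorial, pow_mul]
  congr 2
  ring

lemma summable_pow_div_factorial_mul_factorial {y : ℝ} (hy : 0 ≤ y) :
    Summable fun k : ℕ => y ^ k / ((k.factorial : ℝ) * k.factorial) := by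
  refine Summable.of_nonneg_of_le (fun k => by positivity) (fun k => ?_)
    (Real.summable_pow_div_factorial y)
  have h1 : (1 : ℝ) ≤ k.factorial := by exact_mod_cast k.factorial_pos
  gcongr
  nlinarith

lemma integral_even_pow_mul_sq_sub_sq_pow_succ (T : ℝ) (j k : ℕ) :
    (2 * (j : ℝ) + 1) * ∫ x in (0 : ℝ)..T, x ^ (2 * j) * (T ^ 2 - x ^ 2) ^ (k + 1)
      = 2 * ((k : ℝ) + 1) * ∫ x in (0 : ℝ)..T, x ^ (2 * (j + 1)) * (T ^ 2 - x ^ 2) ^ k := by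
  have hderiv : ∀ x ∈ Set.uIcc 0 T,
      HasDerivAt (fun x : ℝ => x ^ (2 * j + 1) * (T ^ 2 - x ^ 2) ^ (k + 1))
        ((2 * (j : ℝ) + 1) * (x ^ (2 * j) * (T ^ 2 - x ^ 2) ^ (k + 1))
          - 2 * ((k : ℝ) + 1) * (x ^ (2 * (j + 1)) * (T ^ 2 - x ^ 2) ^ k)) x := by
    intro x _
    have h := (hasDerivAt_pow (2 * j + 1) x).mul
      ((((hasDerivAt_pow 2 x).const_sub (T ^ 2))).pow (k + 1))
    refine h.congr_deriv ?_
    simp only [Nat.add_sub_cancel, Pi.pow_apply]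
    push_cast
    ring
  have hftc := integral_eq_sub_of_hasDerivAt hderiv
    (Continuous.intervalIntegrable (by fun_prop) _ _)
  rw [integral_sub (Continuous.intervalIntegrable (by fun_prop) _ _)
    (Continuous.intervalIntegrable (by fun_prop) _ _),
    integral_const_mul, integral_const_mul] at hftc
  simp at hftc
  linarith

lemma integral_even_pow_mul_sq_sub_sq_pow (T : ℝ) (j k : ℕ) :
    ∫ x in (0 : ℝ)..T, x ^ (2 * j) * (T ^ 2 - x ^ 2) ^ k
      = T ^ (2 * (j + k) + 1) * ((2 * j).factorial * 4 ^ k * k.factorial * (j + k).factorial)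
        / (j.factorial * (2 * (j + k) + 1).factorial) := by
  induction k generalizing j with
  | zero =>
    have hj : (j.factorial : ℝ) ≠ 0 := by positivity
    have h2j : ((2 * j).factorial : ℝ) ≠ 0 := by positivity
    simp [Nat.factorial_succ]
    field_simp
  | succ k ih =>
    have hrec := integral_even_pow_mul_sq_sub_sq_pow_succ T j k
    rw [ih (j + 1)] at hrec
    have hpos : (2 * (j : ℝ) + 1) ≠ 0 := by positivity
    apply mul_left_cancel₀ hpos
    rw [hrec, show j + 1 + k = j + (k + 1) by ring, show 2 * (j + 1) = 2 * j + 1 + 1 by ring]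
    have hj : (j.factorial : ℝ) ≠ 0 := by positivity
    have hf : ((2 * (j + (k + 1)) + 1).factorial : ℝ) ≠ 0 := by positivity
    rw [Nat.factorial_succ (2 * j + 1), Nat.factorial_succ (2 * j), Nat.factorial_succ j,
      Nat.factorial_succ k]
    push_cast
    field_simp
    ring

/-- The part of total degree `n` of the product of the power series of `cos (γ x)` and of
`I₀ (a √(T² - x²))`, in the variables `γ²` and `a²`. -/
noncomputable def cosBesselTerm (a γ T : ℝ) (n : ℕ) (x : ℝ) : ℝ :=
  ∑ p ∈ Finset.HasAntidiagonal.antidiagonal n, ((-1) ^ p.1 * (γ * x) ^ (2 * p.1) / (2 * p.1).factorial) *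
    ((a ^ 2 * (T ^ 2 - x ^ 2) / 4) ^ p.2 / ((p.2.factorial : ℝ) * p.2.factorial))

lemma integral_cosBesselTerm (a γ T : ℝ) (n : ℕ) :
    ∫ x in (0 : ℝ)..T, cosBesselTerm a γ T n x
      = T ^ (2 * n + 1) * (a ^ 2 - γ ^ 2) ^ n / (2 * n + 1).factorial := by
  unfold cosBesselTerm
  rw [integral_finsetSum fun p _ => Continuous.intervalIntegrable (by fun_prop) _ _,
    show a ^ 2 - γ ^ 2 = -γ ^ 2 + a ^ 2 by ring, Commute.add_pow' (Commute.all _ _),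
    Finset.mul_sum, Finset.sum_div]
  refine Finset.sum_congr rfl fun p hp => ?_
  obtain ⟨j, k⟩ := p
  obtain rfl : j + k = n := by simpa using hp
  have hfun : ∀ x : ℝ, ((-1) ^ j * (γ * x) ^ (2 * j) / (2 * j).factorial) *
      ((a ^ 2 * (T ^ 2 - x ^ 2) / 4) ^ k / ((k.factorial : ℝ) * k.factorial))
      = ((-γ ^ 2) ^ j * (a ^ 2) ^ k / ((2 * j).factorial * 4 ^ k * k.factorial * k.factorial)) *
        (x ^ (2 * j) * (T ^ 2 - x ^ 2) ^ k) := by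
    intro x
    rw [neg_pow (γ ^ 2) j, mul_pow γ x, div_pow, mul_pow (a ^ 2), pow_mul γ]
    field_simp
  have hchoose : ((j + k).choose j : ℝ) = (j + k).factorial / (j.factorial * k.factorial) :=
    Nat.cast_add_choose ℝ
  simp only [hfun]
  rw [integral_const_mul, integral_even_pow_mul_sq_sub_sq_pow, nsmul_eq_mul, hchoose]
  have h1 : ((2 * j).factorial : ℝ) ≠ 0 := by positivity
  have h2 : (k.factorial : ℝ) ≠ 0 := by positivity
  have h3 : (j.factorial : ℝ) ≠ 0 := by positivity
  have h4 : ((2 * (j + k) + 1).factorial : ℝ) ≠ 0 := by positivity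
  field_simp

lemma hasSum_cosBesselTerm {a γ T x : ℝ} (hx : x ^ 2 ≤ T ^ 2) :
    HasSum (fun n => cosBesselTerm a γ T n x)
      (Real.cos (γ * x) * besselI 0 (a * √(T ^ 2 - x ^ 2))) := by
  have hsub : 0 ≤ T ^ 2 - x ^ 2 := sub_nonneg.2 hx
  have hcos : Summable fun j : ℕ => ‖(-1) ^ j * (γ * x) ^ (2 * j) / ((2 * j).factorial : ℝ)‖ :=
    (Real.hasSum_cos (γ * x)).summable.norm
  have hbes : Summable fun k : ℕ =>
      ‖(a ^ 2 * (T ^ 2 - x ^ 2) / 4) ^ k / ((k.factorial : ℝ) * k.factorial)‖ :=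
    (summable_pow_div_factorial_mul_factorial (by positivity)).norm
  rw [besselI_zero_eq_tsum, mul_pow, Real.sq_sqrt hsub,
    ← (Real.hasSum_cos (γ * x)).tsum_eq,
    tsum_mul_tsum_eq_tsum_sum_antidiagonal_of_summable_norm hcos hbes]
  exact (summable_norm_sum_mul_antidiagonal_of_summable_norm hcos hbes).of_norm.hasSum

lemma norm_cosBesselTerm_le {a γ T x : ℝ} (hx : x ^ 2 ≤ T ^ 2) (n : ℕ) :
    ‖cosBesselTerm a γ T n x‖ ≤ ∑ p ∈ Finset.HasAntidiagonal.antidiagonal n,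
      ((γ * T) ^ (2 * p.1) / (2 * p.1).factorial) *
        ((a ^ 2 * T ^ 2 / 4) ^ p.2 / ((p.2.factorial : ℝ) * p.2.factorial)) := by
  have hsub : 0 ≤ T ^ 2 - x ^ 2 := sub_nonneg.2 hx
  refine norm_sum_le_of_le _ fun p _ => ?_
  have hnonneg : 0 ≤ (a ^ 2 * (T ^ 2 - x ^ 2) / 4) ^ p.2 / ((p.2.factorial : ℝ) * p.2.factorial) :=
    by positivity
  rw [norm_mul, Real.norm_of_nonneg hnonneg, norm_div, norm_mul, norm_pow, norm_neg, norm_one,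
    one_pow, one_mul, Real.norm_natCast, pow_mul, pow_mul, Real.norm_of_nonneg (by positivity)]
  have h1 : (γ * x) ^ 2 ≤ (γ * T) ^ 2 := by
    rw [mul_pow, mul_pow]
    gcongr
  have h2 : T ^ 2 - x ^ 2 ≤ T ^ 2 := by nlinarith [sq_nonneg x]
  gcongr

lemma summable_cosBesselTerm_bound (a γ T : ℝ) :
    Summable fun n => ∑ p ∈ Finset.HasAntidiagonal.antidiagonal n,
      ((γ * T) ^ (2 * p.1) / (2 * p.1).factorial) *
        ((a ^ 2 * T ^ 2 / 4) ^ p.2 / ((p.2.factorial : ℝ) * p.2.factorial)) :=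
  (summable_norm_sum_mul_antidiagonal_of_summable_norm
    (f := fun j : ℕ => (γ * T) ^ (2 * j) / ((2 * j).factorial : ℝ))
    (g := fun k : ℕ => (a ^ 2 * T ^ 2 / 4) ^ k / ((k.factorial : ℝ) * k.factorial))
    (Real.hasSum_cosh (γ * T)).summable.norm
    (summable_pow_div_factorial_mul_factorial (by positivity)).norm).of_norm

lemma hasSum_integral_cos_mul_besselI (a γ : ℝ) {T : ℝ} (hT : 0 ≤ T) :
    HasSum (fun n : ℕ => T ^ (2 * n + 1) * (a ^ 2 - γ ^ 2) ^ n / ((2 * n + 1).factorial : ℝ))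
      (∫ x in (0 : ℝ)..T, Real.cos (γ * x) * besselI 0 (a * √(T ^ 2 - x ^ 2))) := by
  have hle : ∀ x ∈ Set.uIoc 0 T, x ^ 2 ≤ T ^ 2 := by
    intro x hx
    rw [Set.uIoc_of_le hT] at hx
    exact pow_le_pow_left₀ hx.1.le hx.2 2
  simp only [← integral_cosBesselTerm]
  refine hasSum_integral_of_dominated_convergence
    (fun n _ => ∑ p ∈ Finset.HasAntidiagonal.antidiagonal n, ((γ * T) ^ (2 * p.1) / (2 * p.1).factorial) *
        ((a ^ 2 * T ^ 2 / 4) ^ p.2 / ((p.2.factorial : ℝ) * p.2.factorial)))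
    (fun n => ?_) (fun n => ?_) ?_ ?_ ?_
  · unfold cosBesselTerm
    exact Continuous.aestronglyMeasurable (by fun_prop)
  · exact .of_forall fun x hx => norm_cosBesselTerm_le (hle x hx) n
  · exact .of_forall fun x _ => summable_cosBesselTerm_bound a γ T
  · exact intervalIntegrable_const
  · exact .of_forall fun x hx => hasSum_cosBesselTerm (hle x hx)

theorem stmt_1 (lam c t γ : ℝ) (hlam : 0 < lam) (hc : 0 < c) (ht : 0 < t)
    (hγ : |γ| < lam / c) :
    ∫ x in (0:ℝ)..(c * t),
        Real.cos (γ * x) * besselI 0 (lam / c * Real.sqrt (c ^ 2 * t ^ 2 - x ^ 2))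
      = c * Real.sinh (t * Real.sqrt (lam ^ 2 - c ^ 2 * γ ^ 2))
          / Real.sqrt (lam ^ 2 - c ^ 2 * γ ^ 2) := by
  have hpos : 0 < lam ^ 2 - c ^ 2 * γ ^ 2 := by
    have h := (lt_div_iff₀ hc).1 hγ
    have h2 : (|γ| * c) ^ 2 < lam ^ 2 := pow_lt_pow_left₀ h (by positivity) two_ne_zero
    rw [mul_pow, sq_abs] at h2
    linarith
  have hS := Real.sqrt_pos.2 hpos
  have hS2 := Real.sq_sqrt hpos.le
  set S := √(lam ^ 2 - c ^ 2 * γ ^ 2)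
  have hsum := hasSum_integral_cos_mul_besselI (lam / c) γ (mul_pos hc ht).le
  rw [mul_pow c t 2] at hsum
  refine hsum.unique ?_
  have hsinh := ((Real.hasSum_sinh (t * S)).mul_left c).div_const S
  have hdiff : (lam / c) ^ 2 - γ ^ 2 = S ^ 2 / c ^ 2 := by
    rw [hS2]
    field_simp
  have hterm (n : ℕ) : (c * t) ^ (2 * n + 1) * ((lam / c) ^ 2 - γ ^ 2) ^ n
      / ((2 * n + 1).factorial : ℝ) = c * ((t * S) ^ (2 * n + 1) / (2 * n + 1).factorial) / S := by
    rw [hdiff, div_pow, ← pow_mul, ← pow_mul, mul_pow, mul_pow, pow_succ c, pow_succ S]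
    field_simp
  simpa only [hterm] using hsinh
end

section
/- Let λ, c > 0 and t > 0, and let γ be a real number with |γ| < λ/c. Then ∫₀^{ct} sin(γx) I₀((λ/c)√(c²t²−x²)) dx = c²γ ∫₀^{t} ( sinh(s√(λ²−c²γ²))/√(λ²−c²γ²) ) I₀(λ(t−s)) ds. -/
open Real intervalIntegral

open Finset in
/-- Termwise integration of a Cauchy product of two dominated series of continuous functions. -/
lemma integral_tsum_mul_tsum {T : ℝ} (hT : 0 ≤ T) {u v : ℕ → ℝ → ℝ} {U V : ℕ → ℝ}
    (hu : ∀ n, Continuous (u n)) (hv : ∀ n, Continuous (v n))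
    (hU : ∀ n, ∀ x ∈ Set.Icc 0 T, |u n x| ≤ U n) (hV : ∀ n, ∀ x ∈ Set.Icc 0 T, |v n x| ≤ V n)
    (hsU : Summable U) (hsV : Summable V) :
    ∫ x in (0:ℝ)..T, (∑' n, u n x) * (∑' n, v n x)
      = ∑' N, ∑ p ∈ antidiagonal N, ∫ x in (0:ℝ)..T, u p.1 x * v p.2 x := by
  have h0 : (0:ℝ) ∈ Set.Icc 0 T := ⟨le_rfl, hT⟩
  have hU0 : ∀ n, 0 ≤ U n := fun n => (abs_nonneg _).trans (hU n 0 h0)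
  have hV0 : ∀ n, 0 ≤ V n := fun n => (abs_nonneg _).trans (hV n 0 h0)
  have hmem : ∀ x ∈ Set.uIoc 0 T, x ∈ Set.Icc 0 T := fun x hx => by
    rw [Set.uIoc_of_le hT] at hx
    exact Set.Ioc_subset_Icc_self hx
  have hbound : Summable fun N => ∑ p ∈ antidiagonal N, U p.1 * V p.2 :=
    summable_sum_mul_antidiagonal_of_summable_mul (hsU.mul_of_nonneg hsV hU0 hV0)
  have hsum := intervalIntegral.hasSum_integral_of_dominated_convergence
    (μ := MeasureTheory.volume) (a := 0) (b := T)
    (F := fun N x => ∑ p ∈ antidiagonal N, u p.1 x * v p.2 x)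
    (f := fun x => (∑' n, u n x) * (∑' n, v n x))
    (fun N _ => ∑ p ∈ antidiagonal N, U p.1 * V p.2)
    (fun N => (by fun_prop : Continuous _).aestronglyMeasurable)
    (fun N => .of_forall fun x hx => by
      refine (Finset.abs_sum_le_sum_abs _ _).trans (Finset.sum_le_sum fun p _ => ?_)
      rw [abs_mul]
      exact mul_le_mul (hU _ x (hmem x hx)) (hV _ x (hmem x hx)) (abs_nonneg _) (hU0 _))
    (.of_forall fun _ _ => hbound) (by simp)
    (.of_forall fun x hx => by
      have hx := hmem x hx
      have h1 : Summable fun n => ‖u n x‖ :=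
        hsU.of_nonneg_of_le (fun _ => norm_nonneg _) fun n => hU n x hx
      have h2 : Summable fun n => ‖v n x‖ :=
        hsV.of_nonneg_of_le (fun _ => norm_nonneg _) fun n => hV n x hx
      rw [tsum_mul_tsum_eq_tsum_sum_antidiagonal_of_summable_norm h1 h2]
      exact (summable_norm_sum_mul_antidiagonal_of_summable_norm h1 h2).of_norm.hasSum)
  rw [← hsum.tsum_eq]
  refine tsum_congr fun N => ?_
  exact intervalIntegral.integral_finsetSum fun p _ =>
    (by fun_prop : Continuous _).intervalIntegrable _ _

open Nat in
lemma integral_pow_mul_sub_pow (T : ℝ) (p q : ℕ) :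
    ∫ x in (0:ℝ)..T, x ^ p * (T - x) ^ q
      = (p ! : ℝ) * q ! / (p + q + 1)! * T ^ (p + q + 1) := by
  induction q generalizing p with
  | zero =>
    simp only [pow_zero, mul_one, integral_pow, factorial_succ, add_zero]
    have : (p ! : ℝ) ≠ 0 := by positivity
    push_cast
    simp
    field_simp
  | succ q ih =>
    have hd : ∀ x ∈ Set.uIcc 0 T, HasDerivAt (fun x : ℝ => x ^ (p + 1) * (T - x) ^ (q + 1))
        ((p + 1) * (x ^ p * (T - x) ^ (q + 1)) - (q + 1) * (x ^ (p + 1) * (T - x) ^ q)) x := by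
      intro x _
      refine (((hasDerivAt_id x).pow (p + 1)).mul
        (((hasDerivAt_id x).const_sub T).pow (q + 1))).congr_deriv ?_
      simp only [id_eq, Pi.pow_apply, Nat.add_sub_cancel]
      push_cast
      ring
    have h := intervalIntegral.integral_eq_sub_of_hasDerivAt hd
      (Continuous.intervalIntegrable (by fun_prop) _ _)
    rw [intervalIntegral.integral_sub (Continuous.intervalIntegrable (by fun_prop) _ _)
      (Continuous.intervalIntegrable (by fun_prop) _ _), intervalIntegral.integral_const_mul,
      intervalIntegral.integral_const_mul, ih] at h
    have hp : (p + 1 : ℝ) ≠ 0 := by positivity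
    have e : p + (q + 1) + 1 = p + 1 + q + 1 := by ring
    apply mul_left_cancel₀ hp
    rw [e]
    simp at h
    rw [sub_eq_zero.1 h, factorial_succ p, factorial_succ q]
    push_cast
    ring

open Nat in
lemma integral_pow_mul_sq_sub_sq_pow (T : ℝ) (n k : ℕ) :
    ∫ x in (0:ℝ)..T, x ^ (2 * n + 1) * (T ^ 2 - x ^ 2) ^ k
      = (n ! : ℝ) * k ! / (2 * (n + k + 1)!) * T ^ (2 * (n + k) + 2) := by
  induction k generalizing n with
  | zero =>
    simp only [pow_zero, mul_one, integral_pow, factorial_succ, add_zero]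
    have : (n ! : ℝ) ≠ 0 := by positivity
    have : (2 * n + 1 + 1 : ℝ) ≠ 0 := by positivity
    push_cast
    simp
    field_simp
    ring
  | succ k ih =>
    have hd : ∀ x ∈ Set.uIcc 0 T,
        HasDerivAt (fun x : ℝ => x ^ (2 * n + 2) * (T ^ 2 - x ^ 2) ^ (k + 1))
        (2 * (n + 1) * (x ^ (2 * n + 1) * (T ^ 2 - x ^ 2) ^ (k + 1))
          - 2 * (k + 1) * (x ^ (2 * (n + 1) + 1) * (T ^ 2 - x ^ 2) ^ k)) x := by
      intro x _
      refine (((hasDerivAt_id x).pow (2 * n + 2)).mul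
        ((((hasDerivAt_id x).pow 2).const_sub (T ^ 2)).pow (k + 1))).congr_deriv ?_
      simp only [id_eq, Pi.pow_apply, Nat.add_sub_cancel]
      push_cast
      ring
    have h := intervalIntegral.integral_eq_sub_of_hasDerivAt hd
      (Continuous.intervalIntegrable (by fun_prop) _ _)
    rw [intervalIntegral.integral_sub (Continuous.intervalIntegrable (by fun_prop) _ _)
      (Continuous.intervalIntegrable (by fun_prop) _ _), intervalIntegral.integral_const_mul,
      intervalIntegral.integral_const_mul, ih] at h
    have hp : (2 * (n + 1) : ℝ) ≠ 0 := by positivity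
    have e : n + (k + 1) = n + 1 + k := by ring
    apply mul_left_cancel₀ hp
    rw [e]
    simp only [sub_self, ne_eq, add_eq_zero, one_ne_zero, and_false, not_false_eq_true, zero_pow,
      mul_zero, OfNat.ofNat_ne_zero, zero_mul] at h
    rw [sub_eq_zero.1 h, factorial_succ n, factorial_succ k]
    push_cast
    ring

open Nat Finset in
/-- Both sides are the coefficient of `z ^ N` in `1 / ((1 - (4a - b)z) √(1 - 4az))`. -/
lemma sum_antidiagonal_pow_mul_centralBinom (a b : ℝ) (N : ℕ) :
    ∑ p ∈ antidiagonal N, (4 * a - b) ^ p.1 * a ^ p.2 * ((2 * p.2)! / (p.2 ! : ℝ) ^ 2)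
      = ∑ p ∈ antidiagonal N, (-b) ^ p.1 * a ^ p.2 *
          ((2 * (p.1 + p.2) + 2)! * p.1 ! /
            (2 * p.2 ! * (2 * p.1 + 1)! * (p.1 + p.2 + 1)! : ℝ)) := by
  set q : ℕ → ℕ → ℝ := fun n k =>
    (2 * (n + k) + 2)! * n ! / (2 * k ! * (2 * n + 1)! * (n + k + 1)! : ℝ) with hq
  change _ = ∑ p ∈ antidiagonal N, (-b) ^ p.1 * a ^ p.2 * q p.1 p.2
  have hq_succ : ∀ n k, q (n + 1) (k + 1) = q n (k + 1) + 4 * q (n + 1) k := by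
    intro n k
    have e1 : 2 * (n + 1 + (k + 1)) + 2 = 2 * (n + k) + 4 + 1 + 1 := by ring
    have e2 : 2 * (n + (k + 1)) + 2 = 2 * (n + k) + 4 := by ring
    have e3 : 2 * (n + 1 + k) + 2 = 2 * (n + k) + 4 := by ring
    have e4 : 2 * (n + 1) + 1 = 2 * n + 1 + 1 + 1 := by ring
    have e5 : n + 1 + (k + 1) + 1 = n + k + 2 + 1 := by ring
    have e6 : n + (k + 1) + 1 = n + k + 2 := by ring
    have e7 : n + 1 + k + 1 = n + k + 2 := by ring
    simp only [hq, e1, e2, e3, e4, e5, e6, e7]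
    rw [factorial_succ (2 * (n + k) + 4 + 1), factorial_succ (2 * (n + k) + 4),
      factorial_succ (2 * n + 1 + 1), factorial_succ (2 * n + 1), factorial_succ n,
      factorial_succ k, factorial_succ (n + k + 2)]
    push_cast
    field_simp
    ring
  have hq_right : ∀ n, q n 0 = 1 := by
    intro n
    simp only [hq, add_zero]
    rw [factorial_succ (2 * n + 1), factorial_succ n]
    push_cast
    field_simp
    simp
    ring
  have hq_left : ∀ k, q 0 (k + 1) = (2 * (k + 1))! / ((k + 1)! : ℝ) ^ 2 + 4 * q 0 k := by
    intro k
    have e2 : 2 * (k + 1) = 2 * k + 2 := by ring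
    simp only [hq, e2, zero_add]
    rw [factorial_succ (2 * k + 2 + 1), factorial_succ (2 * k + 2), factorial_succ (k + 1),
      factorial_succ k]
    push_cast
    field_simp
    simp
    ring
  induction N with
  | zero => simp [hq_right]
  | succ N ih =>
    set h : ℕ × ℕ → ℝ := fun p => if p.2 = 0 then 0 else
      4 * ((-b) ^ p.1 * a ^ p.2 * q p.1 (p.2 - 1)) with hh
    have h1 := Finset.Nat.sum_antidiagonal_succ (n := N) (f := h)
    have h2 := Finset.Nat.sum_antidiagonal_succ' (n := N) (f := h)
    have h3 : ∑ p ∈ antidiagonal N, h (p.1, p.2 + 1)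
        = 4 * a * ∑ p ∈ antidiagonal N, (-b) ^ p.1 * a ^ p.2 * q p.1 p.2 := by
      rw [Finset.mul_sum]
      refine Finset.sum_congr rfl fun p _ => ?_
      simp [hh]
      ring
    have h4 : ∑ p ∈ antidiagonal N, (-b) ^ (p.1 + 1) * a ^ p.2 * q (p.1 + 1) p.2
        = -b * ∑ p ∈ antidiagonal N, (-b) ^ p.1 * a ^ p.2 * q p.1 p.2
          + ∑ p ∈ antidiagonal N, h (p.1 + 1, p.2) := by
      rw [Finset.mul_sum, ← Finset.sum_add_distrib]
      refine Finset.sum_congr rfl fun p _ => ?_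
      rcases p with ⟨n, _ | k⟩
      · simp [hh, hq_right]
        ring
      · simp [hh, hq_succ]
        ring
    have h5 : h (0, N + 1) = 4 * (a ^ (N + 1) * q 0 N) := by simp [hh]
    have h6 : h (N + 1, 0) = 0 := by simp [hh]
    have h7 : ∑ p ∈ antidiagonal N,
        (4 * a - b) ^ (p.1 + 1) * a ^ p.2 * ((2 * p.2)! / (p.2 ! : ℝ) ^ 2)
        = (4 * a - b) * ∑ p ∈ antidiagonal N, (-b) ^ p.1 * a ^ p.2 * q p.1 p.2 := by
      rw [← ih, Finset.mul_sum]
      refine Finset.sum_congr rfl fun p _ => ?_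
      ring
    rw [Finset.Nat.sum_antidiagonal_succ, Finset.Nat.sum_antidiagonal_succ]
    simp only
    rw [h7, h4, hq_left]
    simp only [pow_zero, one_mul]
    linarith

lemma besselI_zero (x : ℝ) :
    besselI 0 x = ∑' k : ℕ, (x ^ 2 / 4) ^ k / (k.factorial : ℝ) ^ 2 := by
  unfold besselI
  refine tsum_congr fun k => ?_
  rw [zero_add, add_zero, Real.Gamma_nat_eq_factorial, ← sq]
  congr 1
  rw [show (2 * (k : ℝ)) = ((2 * k : ℕ) : ℝ) by push_cast; ring, Real.rpow_natCast, pow_mul]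
  congr 1
  ring

lemma summable_pow_div_factorial_sq (x : ℝ) (hx : 0 ≤ x) :
    Summable fun k : ℕ => x ^ k / (k.factorial : ℝ) ^ 2 := by
  refine (Real.summable_pow_div_factorial x).of_nonneg_of_le (fun k => by positivity) fun k => ?_
  have : (1:ℝ) ≤ k.factorial := by exact_mod_cast k.factorial_pos
  gcongr
  nlinarith

lemma summable_odd_pow_div_factorial (x : ℝ) :
    Summable fun n : ℕ => x ^ (2 * n + 1) / ((2 * n + 1).factorial : ℝ) :=
  (Real.summable_pow_div_factorial x).comp_injective (i := fun n : ℕ => 2 * n + 1)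
    fun a b h => by simpa using h

open Nat in
theorem stmt_2 (lam c t γ : ℝ) (hlam : 0 < lam) (hc : 0 < c) (ht : 0 < t)
    (hγ : |γ| < lam / c) :
    ∫ x in (0:ℝ)..(c * t),
        Real.sin (γ * x) * besselI 0 (lam / c * Real.sqrt (c ^ 2 * t ^ 2 - x ^ 2))
      = c ^ 2 * γ *
          ∫ s in (0:ℝ)..t,
            Real.sinh (s * Real.sqrt (lam ^ 2 - c ^ 2 * γ ^ 2))
              / Real.sqrt (lam ^ 2 - c ^ 2 * γ ^ 2)
              * besselI 0 (lam * (t - s)) := by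
  have hpos : 0 < lam ^ 2 - c ^ 2 * γ ^ 2 := by
    have h1 : |γ| * c < lam := (lt_div_iff₀ hc).1 hγ
    have h2 : (|γ| * c) ^ 2 < lam ^ 2 := by gcongr
    rw [mul_pow, sq_abs] at h2
    linarith
  set μ := Real.sqrt (lam ^ 2 - c ^ 2 * γ ^ 2) with hμ
  have hμ0 : 0 < μ := Real.sqrt_pos.2 hpos
  have hμ2 : μ ^ 2 = lam ^ 2 - c ^ 2 * γ ^ 2 := Real.sq_sqrt hpos.le
  have hct : 0 < c * t := by positivity
  have hL : ∫ x in (0:ℝ)..(c * t),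
        Real.sin (γ * x) * besselI 0 (lam / c * Real.sqrt (c ^ 2 * t ^ 2 - x ^ 2))
      = ∫ x in (0:ℝ)..(c * t),
        (∑' n : ℕ, (-1) ^ n * (γ * x) ^ (2 * n + 1) / ((2 * n + 1)! : ℝ)) *
        ∑' k : ℕ, ((lam / c) ^ 2 * ((c * t) ^ 2 - x ^ 2) / 4) ^ k / (k ! : ℝ) ^ 2 := by
    refine intervalIntegral.integral_congr fun x hx => ?_
    rw [Set.uIcc_of_le hct.le] at hx
    have : 0 ≤ c ^ 2 * t ^ 2 - x ^ 2 := by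
      have := pow_le_pow_left₀ hx.1 hx.2 2
      nlinarith
    rw [besselI_zero, (Real.hasSum_sin _).tsum_eq, mul_pow, Real.sq_sqrt this, mul_pow c t]
  have hR : ∫ s in (0:ℝ)..t, Real.sinh (s * μ) / μ * besselI 0 (lam * (t - s))
      = ∫ s in (0:ℝ)..t,
        (∑' n : ℕ, (s * μ) ^ (2 * n + 1) / ((2 * n + 1)! : ℝ) / μ) *
        ∑' k : ℕ, ((lam * (t - s)) ^ 2 / 4) ^ k / (k ! : ℝ) ^ 2 := by
    refine intervalIntegral.integral_congr fun x hx => ?_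
    rw [besselI_zero, ((Real.hasSum_sinh _).div_const μ).tsum_eq]
  rw [hL, hR]
  rw [integral_tsum_mul_tsum hct.le
    (U := fun n => (|γ| * (c * t)) ^ (2 * n + 1) / ((2 * n + 1)! : ℝ))
    (V := fun k => ((lam / c) ^ 2 * (c * t) ^ 2 / 4) ^ k / (k ! : ℝ) ^ 2)
    (by fun_prop) (by fun_prop)
    (fun n x hx => by
      have h0 := hx.1
      have h1 := hx.2
      rw [abs_div, abs_mul, abs_pow, abs_pow, abs_mul, abs_neg, abs_one, one_pow, one_mul,
        Nat.abs_cast, abs_of_nonneg h0]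
      gcongr)
    (fun k x hx => by
      have h0 := hx.1
      have h1 := hx.2
      have : 0 ≤ (c * t) ^ 2 - x ^ 2 := by
        have := pow_le_pow_left₀ h0 h1 2
        linarith
      rw [abs_of_nonneg (by positivity)]
      gcongr
      nlinarith)
    (summable_odd_pow_div_factorial _)
    (summable_pow_div_factorial_sq _ (by positivity)),
    integral_tsum_mul_tsum ht.le
    (U := fun n => (t * μ) ^ (2 * n + 1) / ((2 * n + 1)! : ℝ) / μ)
    (V := fun k => ((lam * t) ^ 2 / 4) ^ k / (k ! : ℝ) ^ 2)
    (by fun_prop) (by fun_prop)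
    (fun n x hx => by
      have h0 := hx.1
      have h1 := hx.2
      rw [abs_of_nonneg (by positivity)]
      gcongr)
    (fun k x hx => by
      have h0 := hx.1
      have h1 := sub_nonneg.2 hx.2
      rw [abs_of_nonneg (by positivity)]
      gcongr
      linarith)
    ((summable_odd_pow_div_factorial _).div_const _)
    (summable_pow_div_factorial_sq _ (by positivity)), ← tsum_mul_left]
  refine tsum_congr fun N => ?_
  have key := congrArg (fun z => c ^ 2 * γ * t ^ (2 * N + 2) / (2 * N + 2)! * z)
    (sum_antidiagonal_pow_mul_centralBinom (lam ^ 2 / 4) (c ^ 2 * γ ^ 2) N)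
  simp only [Finset.mul_sum] at key
  rw [Finset.mul_sum]
  refine Eq.trans ?_ (key.symm.trans ?_)
  · refine Finset.sum_congr rfl fun p hp => ?_
    obtain ⟨n, k⟩ := p
    obtain rfl : n + k = N := by simpa using hp
    have : ∀ x : ℝ, (-1) ^ n * (γ * x) ^ (2 * n + 1) / ((2 * n + 1)! : ℝ) *
        (((lam / c) ^ 2 * ((c * t) ^ 2 - x ^ 2) / 4) ^ k / (k ! : ℝ) ^ 2)
        = (-1) ^ n * γ ^ (2 * n + 1) / ((2 * n + 1)! : ℝ) *
        (((lam / c) ^ 2 / 4) ^ k / (k ! : ℝ) ^ 2) *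
        (x ^ (2 * n + 1) * ((c * t) ^ 2 - x ^ 2) ^ k) := by
      intro x
      rw [mul_div_right_comm ((lam / c) ^ 2), mul_pow _ ((c * t) ^ 2 - x ^ 2), mul_pow γ]
      ring
    simp only [this]
    rw [intervalIntegral.integral_const_mul, integral_pow_mul_sq_sub_sq_pow]
    have e : (-(c ^ 2 * γ ^ 2)) ^ n = (-1) ^ n * c ^ (2 * n) * γ ^ (2 * n) := by
      rw [neg_pow, mul_pow, ← pow_mul, ← pow_mul]
      ring
    have e' : ((lam / c) ^ 2 / 4) ^ k = (lam ^ 2 / 4) ^ k / c ^ (2 * k) := by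
      rw [pow_mul, ← div_pow]
      congr 1
      ring
    have e'' : (c * t) ^ (2 * (n + k) + 2)
        = c ^ (2 * n) * c ^ (2 * k) * c ^ 2 * t ^ (2 * (n + k) + 2) := by
      rw [mul_pow]
      ring
    rw [e, e', e'', pow_succ γ]
    field_simp
  · refine Finset.sum_congr rfl fun p hp => ?_
    obtain ⟨n, k⟩ := p
    obtain rfl : n + k = N := by simpa using hp
    have : ∀ s : ℝ, (s * μ) ^ (2 * n + 1) / ((2 * n + 1)! : ℝ) / μ *
        (((lam * (t - s)) ^ 2 / 4) ^ k / (k ! : ℝ) ^ 2)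
        = (μ ^ 2) ^ n / ((2 * n + 1)! : ℝ) * ((lam ^ 2 / 4) ^ k / (k ! : ℝ) ^ 2) *
        (s ^ (2 * n + 1) * (t - s) ^ (2 * k)) := by
      intro s
      rw [mul_pow lam, mul_div_right_comm (lam ^ 2), mul_pow _ ((t - s) ^ 2), mul_pow s, pow_succ μ,
        pow_mul μ, pow_mul (t - s)]
      field_simp
    simp only [this]
    rw [intervalIntegral.integral_const_mul, integral_pow_mul_sub_pow, hμ2,
      show 2 * n + 1 + 2 * k + 1 = 2 * (n + k) + 2 by ring,
      show 4 * (lam ^ 2 / 4) - c ^ 2 * γ ^ 2 = lam ^ 2 - c ^ 2 * γ ^ 2 by ring]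
    field_simp
end

section
/- Let λ, c > 0 and let γ be a real number with |γ| < λ/c. Define G(γ,t) = ∫₀^{ct} e^{iγx} I₀((λ/c)√(c²t²−x²)) dx for t ≥ 0. Then G(γ,·) is twice differentiable in t and solves the initial value problem ∂²G/∂t²(γ,t) − (λ²−c²γ²) G(γ,t) = i c²γ I₀(λt) for t > 0, with G(γ,0) = 0 and ∂G/∂t(γ,t)|_{t=0} = c. -/
open Real intervalIntegral

/-- `G(γ,t) = ∫₀^{ct} e^{iγx} I₀((λ/c)√(c²t²−x²)) dx`. -/
noncomputable def Gfun (lam c γ t : ℝ) : ℂ :=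
  ∫ x in (0:ℝ)..(c * t),
    Complex.exp (Complex.I * γ * x) *
      (besselI 0 (lam / c * Real.sqrt (c ^ 2 * t ^ 2 - x ^ 2)) : ℂ)

open Filter Topology

/-- The entire function `x ↦ ∑ x^k / (k! (k+n)!)`, for which `I₀(x) = besselAux 0 (x²/4)`. -/
noncomputable def besselAux (n : ℕ) (x : ℝ) : ℝ :=
  ∑' k : ℕ, x ^ k / ((k.factorial : ℝ) * ((k + n).factorial : ℝ))

theorem summable_besselAux (n : ℕ) (x : ℝ) :
    Summable fun k : ℕ => x ^ k / ((k.factorial : ℝ) * ((k + n).factorial : ℝ)) := by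
  refine Summable.of_norm_bounded (Real.summable_pow_div_factorial |x|) fun k => ?_
  rw [norm_div, norm_pow, Real.norm_eq_abs, Real.norm_of_nonneg (by positivity)]
  gcongr
  exact le_mul_of_one_le_right (by positivity) (by exact_mod_cast Nat.factorial_pos _)

theorem hasDerivAt_besselAux (n : ℕ) (x : ℝ) :
    HasDerivAt (besselAux n) (besselAux (n + 1) x) x := by
  have hterm (k : ℕ) (y : ℝ) :
      ((k + 1 : ℕ) : ℝ) * y ^ k / (((k + 1).factorial : ℝ) * ((k + 1 + n).factorial : ℝ))
        = y ^ k / ((k.factorial : ℝ) * ((k + (n + 1)).factorial : ℝ)) := by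
    rw [Nat.factorial_succ k, show k + 1 + n = k + (n + 1) by ring]
    push_cast
    field_simp
  have hsum : besselAux (n + 1) x
      = ∑' k : ℕ, (k : ℝ) * x ^ (k - 1) / ((k.factorial : ℝ) * ((k + n).factorial : ℝ)) := by
    rw [Summable.tsum_eq_zero_add]
    · simp only [Nat.add_sub_cancel, hterm]
      simp [besselAux]
    · rw [← summable_nat_add_iff 1]
      simp only [Nat.add_sub_cancel, hterm]
      exact summable_besselAux (n + 1) x
  rw [hsum]
  refine hasDerivAt_tsum_of_isPreconnected (t := Metric.ball (0 : ℝ) (|x| + 1)) (y₀ := x)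
    (g := fun k y => y ^ k / ((k.factorial : ℝ) * ((k + n).factorial : ℝ)))
    (g' := fun k y => (k : ℝ) * y ^ (k - 1) / ((k.factorial : ℝ) * ((k + n).factorial : ℝ)))
    (u := fun k : ℕ => (k : ℝ) * (|x| + 1) ^ (k - 1) /
      ((k.factorial : ℝ) * ((k + n).factorial : ℝ))) ?_ Metric.isOpen_ball
    (convex_ball _ _).isPreconnected ?_ ?_ (by simp) (summable_besselAux n x) (by simp)
  · rw [← summable_nat_add_iff 1]
    simp only [Nat.add_sub_cancel, hterm]
    exact summable_besselAux (n + 1) _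
  · intro k y _
    exact (hasDerivAt_pow k y).div_const _
  · intro k y hy
    rw [mem_ball_zero_iff, Real.norm_eq_abs] at hy
    rw [norm_div, norm_mul, norm_pow, Real.norm_eq_abs y, Real.norm_of_nonneg (by positivity),
      Real.norm_of_nonneg (by positivity)]
    gcongr

theorem continuous_besselAux (n : ℕ) : Continuous (besselAux n) :=
  continuous_iff_continuousAt.2 fun x => (hasDerivAt_besselAux n x).continuousAt

theorem besselAux_zero_zero : besselAux 0 0 = 1 := by
  rw [besselAux, tsum_eq_single 0 fun k hk => by simp [hk]]
  simp

/-- The differential equation `x f'' + f' = f` satisfied by `besselAux 0`. -/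
theorem besselAux_recurrence (x : ℝ) :
    besselAux 1 x + x * besselAux 2 x = besselAux 0 x := by
  have h0 := (summable_besselAux 0 x).tsum_eq_zero_add
  have h1 := (summable_besselAux 1 x).tsum_eq_zero_add
  have s0 := (summable_nat_add_iff 1).2 (summable_besselAux 0 x)
  have s1 := (summable_nat_add_iff 1).2 (summable_besselAux 1 x)
  have hd : ∑' k : ℕ, x ^ (k + 1) / (((k + 1).factorial : ℝ) * ((k + 1 + 0).factorial : ℝ))
      - ∑' k : ℕ, x ^ (k + 1) / (((k + 1).factorial : ℝ) * ((k + 1 + 1).factorial : ℝ))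
      = x * besselAux 2 x := by
    rw [← s0.tsum_sub s1, besselAux, ← tsum_mul_left]
    congr 1 with k
    rw [add_zero, show k + 2 = k + 1 + 1 by ring, Nat.factorial_succ (k + 1), Nat.factorial_succ k]
    push_cast
    field_simp
    ring
  have e0 : besselAux 0 x = _ := h0
  have e1 : besselAux 1 x = _ := h1
  rw [e0, e1, ← hd]
  simp

theorem besselI_zero_eq_besselAux (x : ℝ) : besselI 0 x = besselAux 0 (x ^ 2 / 4) := by
  rw [besselI, besselAux]
  congr 1 with k
  rw [add_zero, zero_add, add_zero, Real.Gamma_nat_eq_factorial,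
    show (2 * (k : ℝ)) = ((2 * k : ℕ) : ℝ) by push_cast; ring, Real.rpow_natCast, pow_mul]
  ring_nf

/-- Leibniz rule for an integral whose integrand and upper limit both depend on the parameter. -/
theorem hasDerivAt_integral_const_mul {h h' : ℝ → ℝ → ℂ} (c : ℝ)
    (hcont : Continuous fun p : ℝ × ℝ => h p.1 p.2)
    (hcont' : Continuous fun p : ℝ × ℝ => h' p.1 p.2)
    (hderiv : ∀ x t, HasDerivAt (h x) (h' x t) t) (t : ℝ) :
    HasDerivAt (fun s => ∫ x in (0 : ℝ)..(c * s), h x s)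
      (c * h (c * t) t + ∫ x in (0 : ℝ)..(c * t), h' x t) t := by
  have hx (s : ℝ) : Continuous fun x => h x s :=
    hcont.comp (continuous_id.prodMk continuous_const)
  have hx' (s : ℝ) : Continuous fun x => h' x s :=
    hcont'.comp (continuous_id.prodMk continuous_const)
  have d1 (a s : ℝ) : HasDerivAt (fun a => ∫ x in (0 : ℝ)..a, h x s) (h a s) a :=
    integral_hasDerivAt_right ((hx s).intervalIntegrable _ _)
      (hx s).stronglyMeasurable.stronglyMeasurableAtFilter (hx s).continuousAt
  have d2 (a s : ℝ) :
      HasDerivAt (fun s => ∫ x in (0 : ℝ)..a, h x s) (∫ x in (0 : ℝ)..a, h' x s) s := by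
    obtain ⟨C, hC⟩ := ((isCompact_uIcc (a := (0 : ℝ)) (b := a)).prod
      (isCompact_closedBall s 1)).exists_bound_of_continuousOn hcont'.continuousOn
    refine (intervalIntegral.hasDerivAt_integral_of_dominated_loc_of_deriv_le (bound := fun _ => C)
      (F := fun s x => h x s) (F' := fun s x => h' x s)
      (Metric.closedBall_mem_nhds s one_pos) ?_ ((hx s).intervalIntegrable _ _)
      (hx' s).aestronglyMeasurable ?_ intervalIntegrable_const ?_).2
    · exact Eventually.of_forall fun s => (hx s).aestronglyMeasurable
    · exact Eventually.of_forall fun x hx s hs => hC (x, s) ⟨Set.uIoc_subset_uIcc hx, hs⟩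
    · exact Eventually.of_forall fun x _ s _ => hderiv x s
  have c2 : Continuous fun p : ℝ × ℝ => ∫ x in (0 : ℝ)..p.1, h' x p.2 :=
    continuous_parametric_intervalIntegral_of_continuous
      (f := fun (p : ℝ × ℝ) x => h' x p.2)
      (hcont'.comp (continuous_snd.prodMk (continuous_snd.comp continuous_fst))) continuous_fst
  have key := hasStrictFDerivAt_uncurry_coprod (𝕜 := ℝ) (u := (c * t, t))
    (f := fun a s => ∫ x in (0 : ℝ)..a, h x s)
    (f₁ := fun a s => ContinuousLinearMap.toSpanSingleton ℝ (h a s))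
    (f₂ := fun a s => ContinuousLinearMap.toSpanSingleton ℝ (∫ x in (0 : ℝ)..a, h' x s))
    (Eventually.of_forall fun v => (d1 v.1 v.2).hasFDerivAt)
    (Eventually.of_forall fun v => (d2 v.1 v.2).hasFDerivAt)
    ((ContinuousLinearMap.toSpanSingletonCLE (𝕜 := ℝ) (E := ℂ)).continuous.comp
      hcont).continuousAt
    ((ContinuousLinearMap.toSpanSingletonCLE (𝕜 := ℝ) (E := ℂ)).continuous.comp
      c2).continuousAt
  have hpath : HasDerivAt (fun s : ℝ => (c * s, s)) (c, 1) t :=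
    (by simpa using (hasDerivAt_id t).const_mul c : HasDerivAt (fun s => c * s) c t).prodMk
      (hasDerivAt_id t)
  convert! key.hasFDerivAt.comp_hasDerivAt (f := fun s : ℝ => (c * s, s)) t hpath using 1
  simp [Function.HasUncurry.uncurry]

/-- Space derivative of `x ↦ besselAux n (b (c² t² - x²))`, viewed in `ℂ`. -/
theorem hasDerivAt_besselAux_space (n : ℕ) (b c t x : ℝ) :
    HasDerivAt (fun x : ℝ => (besselAux n (b * (c ^ 2 * t ^ 2 - x ^ 2)) : ℂ))
      ((-2 * b * x : ℝ) * (besselAux (n + 1) (b * (c ^ 2 * t ^ 2 - x ^ 2)) : ℂ)) x := by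
  have hq : HasDerivAt (fun x : ℝ => b * (c ^ 2 * t ^ 2 - x ^ 2)) (-2 * b * x) x := by
    convert! ((hasDerivAt_pow 2 x).const_sub (c ^ 2 * t ^ 2)).const_mul b using 1
    norm_num; ring
  convert! ((hasDerivAt_besselAux n _).comp x hq).ofReal_comp using 1
  push_cast; ring

/-- Time derivative of `t ↦ besselAux n (b (c² t² - x²))`, viewed in `ℂ`. -/
theorem hasDerivAt_besselAux_time (n : ℕ) (b c x t : ℝ) :
    HasDerivAt (fun t : ℝ => (besselAux n (b * (c ^ 2 * t ^ 2 - x ^ 2)) : ℂ))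
      ((2 * b * c ^ 2 * t : ℝ) * (besselAux (n + 1) (b * (c ^ 2 * t ^ 2 - x ^ 2)) : ℂ)) t := by
  have hq : HasDerivAt (fun t : ℝ => b * (c ^ 2 * t ^ 2 - x ^ 2)) (2 * b * c ^ 2 * t) t := by
    convert! (((hasDerivAt_pow 2 t).const_mul (c ^ 2)).sub_const (x ^ 2)).const_mul b using 1
    norm_num; ring
  convert! ((hasDerivAt_besselAux n _).comp t hq).ofReal_comp using 1
  push_cast; ring

theorem hasDerivAt_cexp_I_mul (γ x : ℝ) :
    HasDerivAt (fun x : ℝ => Complex.exp (Complex.I * γ * x))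
      (Complex.I * γ * Complex.exp (Complex.I * γ * x)) x := by
  convert! ((hasDerivAt_id x).ofReal_comp.const_mul (Complex.I * γ)).cexp using 1
  simp; ring

theorem Gfun_eq_integral_besselAux {lam c : ℝ} (hc : c ≠ 0) (γ t : ℝ) :
    Gfun lam c γ t = ∫ x in (0 : ℝ)..(c * t), Complex.exp (Complex.I * γ * x) *
      (besselAux 0 (lam ^ 2 / (4 * c ^ 2) * (c ^ 2 * t ^ 2 - x ^ 2)) : ℂ) := by
  refine integral_congr fun x hx => ?_
  have hx2 : 0 ≤ c ^ 2 * t ^ 2 - x ^ 2 := by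
    rw [← mul_pow, sub_nonneg, sq_le_sq]
    simpa using Set.abs_sub_left_of_mem_uIcc hx
  simp only [besselI_zero_eq_besselAux, mul_pow, Real.sq_sqrt hx2]
  congr 3
  field_simp

theorem hasDerivAt_Gfun {lam c : ℝ} (hc : c ≠ 0) (γ t : ℝ) :
    HasDerivAt (Gfun lam c γ)
      (c * Complex.exp (Complex.I * γ * (c * t : ℝ)) +
        ∫ x in (0 : ℝ)..(c * t), Complex.exp (Complex.I * γ * x) *
          ((2 * (lam ^ 2 / (4 * c ^ 2)) * c ^ 2 * t : ℝ) *
            (besselAux 1 (lam ^ 2 / (4 * c ^ 2) * (c ^ 2 * t ^ 2 - x ^ 2)) : ℂ))) t := by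
  have c0 := continuous_besselAux 0
  have c1 := continuous_besselAux 1
  have := hasDerivAt_integral_const_mul c (by fun_prop) (by fun_prop)
    (fun x t => (hasDerivAt_besselAux_time 0 (lam ^ 2 / (4 * c ^ 2)) c x t).const_mul
      (Complex.exp (Complex.I * γ * x))) t
  rw [funext (Gfun_eq_integral_besselAux hc γ)]
  convert! this using 3
  rw [mul_pow, sub_self, mul_zero, besselAux_zero_zero, Complex.ofReal_one, mul_one]

theorem hasDerivAt_deriv_Gfun {lam c : ℝ} (hc : c ≠ 0) (γ t : ℝ) :
    HasDerivAt (deriv (Gfun lam c γ))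
      ((lam ^ 2 - c ^ 2 * γ ^ 2 : ℝ) * Gfun lam c γ t
        + Complex.I * (c : ℂ) ^ 2 * γ * (besselI 0 (lam * t) : ℂ)) t := by
  rw [funext fun t => (hasDerivAt_Gfun (lam := lam) hc γ t).deriv, Gfun_eq_integral_besselAux hc]
  have c0 := continuous_besselAux 0
  have c1 := continuous_besselAux 1
  have c2 := continuous_besselAux 2
  have hlam : besselI 0 (lam * t) = besselAux 0 (lam ^ 2 / (4 * c ^ 2) * (c ^ 2 * t ^ 2)) := by
    rw [besselI_zero_eq_besselAux]
    congr 1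
    field_simp
  have hb : lam ^ 2 = 4 * c ^ 2 * (lam ^ 2 / (4 * c ^ 2)) := by field_simp
  rw [hlam]
  set b := lam ^ 2 / (4 * c ^ 2)
  rw [hb]
  have hexp : HasDerivAt (fun t : ℝ => (c : ℂ) * Complex.exp (Complex.I * γ * (c * t : ℝ)))
      (c * (c * (Complex.I * γ * Complex.exp (Complex.I * γ * (c * t : ℝ))))) t := by
    have hct : HasDerivAt (fun s => c * s) c t := by simpa using (hasDerivAt_id t).const_mul c
    exact ((hasDerivAt_cexp_I_mul γ (c * t)).scomp t hct).const_mul (c : ℂ)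
  have hlin (s : ℝ) : HasDerivAt (fun s : ℝ => ((2 * b * c ^ 2 * s : ℝ) : ℂ))
      ((2 * b * c ^ 2 : ℝ) : ℂ) s := by
    simpa only [id, mul_one] using ((hasDerivAt_id s).const_mul (2 * b * c ^ 2)).ofReal_comp
  have hint := hasDerivAt_integral_const_mul c (by fun_prop) (by fun_prop)
    (fun x t => ((hlin t).fun_mul (hasDerivAt_besselAux_time 1 b c x t)).const_mul
      (Complex.exp (Complex.I * γ * x))) t
  have hparts : ∀ x : ℝ, HasDerivAt
      (fun x : ℝ => (c : ℂ) ^ 2 * (Complex.exp (Complex.I * γ * x) *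
        ((-2 * b * x : ℝ) * (besselAux 1 (b * (c ^ 2 * t ^ 2 - x ^ 2)) : ℂ)
          - Complex.I * γ * (besselAux 0 (b * (c ^ 2 * t ^ 2 - x ^ 2)) : ℂ))))
      (Complex.exp (Complex.I * γ * x) *
        ((2 * b * c ^ 2 : ℝ) * (besselAux 1 (b * (c ^ 2 * t ^ 2 - x ^ 2)) : ℂ)
          + (2 * b * c ^ 2 * t : ℝ) * ((2 * b * c ^ 2 * t : ℝ) *
            (besselAux 2 (b * (c ^ 2 * t ^ 2 - x ^ 2)) : ℂ)))
        - (4 * c ^ 2 * b - c ^ 2 * γ ^ 2 : ℝ) * (Complex.exp (Complex.I * γ * x) *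
          (besselAux 0 (b * (c ^ 2 * t ^ 2 - x ^ 2)) : ℂ))) x := by
    intro x
    have hx : HasDerivAt (fun x : ℝ => ((-2 * b * x : ℝ) : ℂ)) ((-2 * b : ℝ) : ℂ) x := by
      simpa only [id, mul_one] using ((hasDerivAt_id x).const_mul (-2 * b)).ofReal_comp
    convert! ((hasDerivAt_cexp_I_mul γ x).fun_mul
      ((hx.fun_mul (hasDerivAt_besselAux_space 1 b c t x)).fun_sub
        ((hasDerivAt_besselAux_space 0 b c t x).const_mul
          (Complex.I * γ)))).const_mul ((c : ℂ) ^ 2) using 1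
    rw [← besselAux_recurrence (b * (c ^ 2 * t ^ 2 - x ^ 2))]
    push_cast
    linear_combination ((c : ℂ) ^ 2 * γ ^ 2 * Complex.exp (Complex.I * γ * x) *
      (besselAux 1 (b * (c ^ 2 * t ^ 2 - x ^ 2)) + b * (c ^ 2 * t ^ 2 - x ^ 2) *
        besselAux 2 (b * (c ^ 2 * t ^ 2 - x ^ 2)))) * Complex.I_sq
  have hftc := integral_eq_sub_of_hasDerivAt (a := 0) (b := c * t) (fun x _ => hparts x)
    (Continuous.intervalIntegrable (by fun_prop) _ _)
  rw [integral_sub (Continuous.intervalIntegrable (by fun_prop) _ _)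
    (Continuous.intervalIntegrable (by fun_prop) _ _), integral_const_mul] at hftc
  convert! hexp.add hint using 1
  rw [sub_eq_iff_eq_add] at hftc
  refine Eq.trans ?_ (congrArg (fun z => _ + (_ + z)) hftc.symm)
  simp only [mul_pow, sub_self, mul_zero, besselAux_zero_zero]
  push_cast
  simp
  ring

theorem stmt_10 (lam c γ : ℝ) (hlam : 0 < lam) (hc : 0 < c) (hγ : |γ| < lam / c) :
    (∀ t : ℝ, 0 ≤ t → DifferentiableAt ℝ (Gfun lam c γ) t ∧
        DifferentiableAt ℝ (deriv (Gfun lam c γ)) t) ∧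
    (∀ t : ℝ, 0 < t →
        deriv (deriv (Gfun lam c γ)) t
            - ((lam ^ 2 - c ^ 2 * γ ^ 2 : ℝ) : ℂ) * Gfun lam c γ t
          = Complex.I * (c : ℂ) ^ 2 * (γ : ℂ) * ((besselI 0 (lam * t) : ℝ) : ℂ)) ∧
    Gfun lam c γ 0 = 0 ∧
    deriv (Gfun lam c γ) 0 = (c : ℂ) := by
  refine ⟨fun t _ => ⟨(hasDerivAt_Gfun hc.ne' γ t).differentiableAt,
    (hasDerivAt_deriv_Gfun hc.ne' γ t).differentiableAt⟩, fun t _ => ?_, ?_, ?_⟩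
  · rw [(hasDerivAt_deriv_Gfun hc.ne' γ t).deriv]
    ring
  · simp [Gfun]
  · rw [(hasDerivAt_Gfun hc.ne' γ 0).deriv]
    simp
end

section
/- Let λ, c > 0. On the open region {(x,t) : t > 0, |x| < ct}, the function p⁻_{λ,c}(x,t) satisfies the telegraph equation ∂²p⁻/∂t² + 2λ ∂p⁻/∂t = c² ∂²p⁻/∂x². -/
open Real

/-- Absolutely continuous component of the law of the telegraph process with
initial negative velocity. -/
noncomputable def pminus (lam c x t : ℝ) : ℝ :=
  lam * Real.exp (-(lam * t)) / (2 * c) *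
    (Real.sqrt ((c * t - x) / (c * t + x)) *
        besselI 1 (lam / c * Real.sqrt (c ^ 2 * t ^ 2 - x ^ 2))
      + besselI 0 (lam / c * Real.sqrt (c ^ 2 * t ^ 2 - x ^ 2)))

/-- The entire function `z ↦ ∑_{k≥0} z^k / (k! (k+n)!)`, so that
`I_n(y) = (y/2)^n * besselEntire n (y²/4)`. -/
noncomputable def besselEntire (n : ℕ) (z : ℝ) : ℝ :=
  ∑' k : ℕ, z ^ k / ((k.factorial : ℝ) * ((k + n).factorial : ℝ))

lemma summable_besselEntire (n : ℕ) (z : ℝ) :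
    Summable fun k : ℕ => z ^ k / ((k.factorial : ℝ) * ((k + n).factorial : ℝ)) := by
  refine Summable.of_norm_bounded (Real.summable_pow_div_factorial |z|) fun k => ?_
  have h1 : (0 : ℝ) < k.factorial := by positivity
  have h2 : (1 : ℝ) ≤ (k + n).factorial := by exact_mod_cast Nat.factorial_pos _
  rw [norm_div, norm_pow, Real.norm_eq_abs, Real.norm_of_nonneg (by positivity)]
  gcongr
  nlinarith

lemma succ_mul_pow_div_factorial (n k : ℕ) (z : ℝ) :
    ((k + 1 : ℕ) : ℝ) * z ^ (k + 1 - 1)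
        / (((k + 1).factorial : ℝ) * ((k + 1 + n).factorial : ℝ))
      = z ^ k / ((k.factorial : ℝ) * ((k + (n + 1)).factorial : ℝ)) := by
  rw [show k + 1 + n = k + (n + 1) by ring, Nat.factorial_succ k, Nat.add_sub_cancel]
  have : ((k + 1 : ℕ) : ℝ) ≠ 0 := by positivity
  push_cast at this ⊢
  field_simp

lemma hasDerivAt_besselEntire (n : ℕ) (z : ℝ) :
    HasDerivAt (besselEntire n) (besselEntire (n + 1) z) z := by
  have hs (y : ℝ) : Summable fun k : ℕ =>
      (k : ℝ) * y ^ (k - 1) / ((k.factorial : ℝ) * ((k + n).factorial : ℝ)) := by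
    rw [← summable_nat_add_iff 1]
    simpa only [succ_mul_pow_div_factorial] using summable_besselEntire (n + 1) y
  have h := hasDerivAt_tsum_of_isPreconnected (hs (|z| + 1)) Metric.isOpen_ball
    (convex_ball (0 : ℝ) (|z| + 1)).isPreconnected
    (g := fun (k : ℕ) y => y ^ k / ((k.factorial : ℝ) * ((k + n).factorial : ℝ)))
    (g' := fun (k : ℕ) y =>
      (k : ℝ) * y ^ (k - 1) / ((k.factorial : ℝ) * ((k + n).factorial : ℝ)))
    (fun k y _ => (hasDerivAt_pow k y).div_const _)
    (fun k y hy => by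
      have hy' : |y| ≤ |z| + 1 := by
        have := mem_ball_zero_iff.mp hy
        rw [Real.norm_eq_abs] at this
        exact this.le
      rw [norm_div, norm_mul, norm_pow, Real.norm_eq_abs y,
        Real.norm_of_nonneg (by positivity : (0 : ℝ) ≤ k),
        Real.norm_of_nonneg (by positivity : (0 : ℝ) ≤ k.factorial * (k + n).factorial)]
      gcongr)
    (y₀ := z) (by simp) (summable_besselEntire n z) (y := z) (by simp)
  rw [(hs z).tsum_eq_zero_add] at h
  simp only [succ_mul_pow_div_factorial, Nat.cast_zero, zero_mul, zero_div, zero_add] at h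
  exact h

lemma besselEntire_recurrence (n : ℕ) (z : ℝ) :
    besselEntire n z = (n + 1) * besselEntire (n + 1) z + z * besselEntire (n + 2) z := by
  have h : z * besselEntire (n + 2) z = ∑' k : ℕ,
      (k : ℝ) * (z ^ k / ((k.factorial : ℝ) * ((k + (n + 1)).factorial : ℝ))) := by
    have hk (k : ℕ) : ((k + 1 : ℕ) : ℝ)
          * (z ^ (k + 1) / (((k + 1).factorial : ℝ) * ((k + 1 + (n + 1)).factorial : ℝ)))
        = z * (z ^ k / ((k.factorial : ℝ) * ((k + (n + 2)).factorial : ℝ))) := by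
      rw [← succ_mul_pow_div_factorial (n + 1) k z, Nat.add_sub_cancel]
      ring
    rw [tsum_eq_zero_add']
    · simp only [hk, tsum_mul_left]
      simp [besselEntire]
    · simpa only [hk] using (summable_besselEntire (n + 2) z).mul_left z
  have hs : Summable fun k : ℕ =>
      (k : ℝ) * (z ^ k / ((k.factorial : ℝ) * ((k + (n + 1)).factorial : ℝ))) := by
    rw [← summable_nat_add_iff 1]
    refine ((summable_besselEntire (n + 2) z).mul_left z).congr fun k => ?_
    rw [← succ_mul_pow_div_factorial (n + 1) k z, Nat.add_sub_cancel]
    ring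
  rw [h, besselEntire, besselEntire, ← tsum_mul_left,
    ← ((summable_besselEntire (n + 1) z).mul_left _).tsum_add hs]
  refine tsum_congr fun k => ?_
  rw [← add_assoc k n 1, Nat.factorial_succ (k + n)]
  have : ((k + n + 1 : ℕ) : ℝ) ≠ 0 := by positivity
  push_cast at this ⊢
  field_simp
  ring

lemma besselI_natCast (n : ℕ) (y : ℝ) :
    besselI n y = (y / 2) ^ n * besselEntire n (y ^ 2 / 4) := by
  rw [besselI, besselEntire, ← tsum_mul_left]
  refine tsum_congr fun k => ?_
  rw [show (2 * (k : ℝ) + n) = ((2 * k + n : ℕ) : ℝ) by push_cast; ring, Real.rpow_natCast,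
    show (n : ℝ) + k + 1 = ((k + n : ℕ) : ℝ) + 1 by push_cast; ring, Real.Gamma_nat_eq_factorial,
    pow_add, pow_mul, show (y / 2) ^ 2 = y ^ 2 / 4 by ring]
  ring

/-- The argument `(λ/c)²(c²t² - x²)/4` of the entire functions representing `pminus`. -/
noncomputable def pminusArg (lam c x t : ℝ) : ℝ :=
  lam ^ 2 / (4 * c ^ 2) * (c ^ 2 * t ^ 2 - x ^ 2)

lemma pminus_eq_besselEntire {lam c x t : ℝ} (h : |x| < c * t) :
    pminus lam c x t = lam / (2 * c) * (Real.exp (-(lam * t)) *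
      (lam / (2 * c) * (c * t - x) * besselEntire 1 (pminusArg lam c x t)
        + besselEntire 0 (pminusArg lam c x t))) := by
  obtain ⟨h1, h2⟩ := abs_lt.mp h
  have hp : 0 < c * t + x := by linarith
  have hm : 0 < c * t - x := by linarith
  have hw : c ^ 2 * t ^ 2 - x ^ 2 = (c * t - x) * (c * t + x) := by ring
  have harg : (lam / c * √(c ^ 2 * t ^ 2 - x ^ 2)) ^ 2 / 4 = pminusArg lam c x t := by
    rw [mul_pow, Real.sq_sqrt (by rw [hw]; positivity), pminusArg]
    ring
  have hsqrt : √((c * t - x) / (c * t + x)) * √(c ^ 2 * t ^ 2 - x ^ 2) = c * t - x := by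
    rw [hw, ← Real.sqrt_mul (by positivity), ← Real.sqrt_sq hm.le]
    congr 1
    rw [Real.sqrt_sq hm.le]
    field_simp
  have hI0 := besselI_natCast 0 (lam / c * √(c ^ 2 * t ^ 2 - x ^ 2))
  have hI1 := besselI_natCast 1 (lam / c * √(c ^ 2 * t ^ 2 - x ^ 2))
  rw [harg] at hI0 hI1
  push_cast at hI0 hI1
  rw [pminus, hI0, hI1]
  linear_combination (lam * Real.exp (-(lam * t)) / (2 * c) * (lam / (2 * c))
    * besselEntire 1 (pminusArg lam c x t)) * hsqrt

lemma hasDerivAt_besselEntire_pminusArg_time (n : ℕ) (lam x t : ℝ) {c : ℝ} (hc : c ≠ 0) :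
    HasDerivAt (fun u => besselEntire n (pminusArg lam c x u))
      (besselEntire (n + 1) (pminusArg lam c x t) * (lam ^ 2 / 2 * t)) t := by
  have h : HasDerivAt (pminusArg lam c x) (lam ^ 2 / 2 * t) t := by
    refine (((((hasDerivAt_id t).pow 2).const_mul (c ^ 2)).sub_const (x ^ 2)).const_mul
      (lam ^ 2 / (4 * c ^ 2))).congr_deriv ?_
    simp
    field_simp
    ring
  exact (hasDerivAt_besselEntire n _).comp t h

lemma hasDerivAt_besselEntire_pminusArg_space (n : ℕ) (lam c x t : ℝ) :
    HasDerivAt (fun y => besselEntire n (pminusArg lam c y t))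
      (besselEntire (n + 1) (pminusArg lam c x t) * (-(lam ^ 2 / (2 * c ^ 2)) * x)) x := by
  have h : HasDerivAt (fun y => pminusArg lam c y t) (-(lam ^ 2 / (2 * c ^ 2)) * x) x := by
    refine ((((hasDerivAt_id x).pow 2).const_sub (c ^ 2 * t ^ 2)).const_mul
      (lam ^ 2 / (4 * c ^ 2))).congr_deriv ?_
    simp
    ring
  exact (hasDerivAt_besselEntire n _).comp x h

theorem stmt_12 (lam c : ℝ) (hlam : 0 < lam) (hc : 0 < c) :
    ∀ x t : ℝ, 0 < t → |x| < c * t →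
      deriv (fun s => deriv (fun u => pminus lam c x u) s) t
          + 2 * lam * deriv (fun u => pminus lam c x u) t
        = c ^ 2 * deriv (fun y => deriv (fun z => pminus lam c z t) y) x := by
  intro x t _ hxt
  have hc0 := hc.ne'
  let B (n : ℕ) (y s : ℝ) : ℝ := besselEntire n (pminusArg lam c y s)
  let q (y s : ℝ) : ℝ := lam / (2 * c) * (Real.exp (-(lam * s)) *
    (lam / (2 * c) * (c * s - y) * B 1 y s + B 0 y s))
  have hBt (n : ℕ) (s : ℝ) : HasDerivAt (fun u => B n x u)
      (B (n + 1) x s * (lam ^ 2 / 2 * s)) s :=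
    hasDerivAt_besselEntire_pminusArg_time n lam x s hc0
  have hBx (n : ℕ) (y : ℝ) : HasDerivAt (fun z => B n z t)
      (B (n + 1) y t * (-(lam ^ 2 / (2 * c ^ 2)) * y)) y :=
    hasDerivAt_besselEntire_pminusArg_space n lam c y t
  have hexp (s : ℝ) : HasDerivAt (fun u => Real.exp (-(lam * u)))
      (Real.exp (-(lam * s)) * -(lam * 1)) s :=
    ((hasDerivAt_id s).const_mul lam).neg.exp
  have hlt (s : ℝ) : HasDerivAt (fun u => lam / (2 * c) * (c * u - x))
      (lam / (2 * c) * (c * 1)) s :=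
    (((hasDerivAt_id s).const_mul c).sub_const x).const_mul _
  have hlx (y : ℝ) : HasDerivAt (fun z => lam / (2 * c) * (c * t - z)) (lam / (2 * c) * -1) y :=
    ((hasDerivAt_id y).const_sub (c * t)).const_mul _
  have hid (s a : ℝ) : HasDerivAt (fun u => a * u) (a * 1) s :=
    (hasDerivAt_id s).const_mul a
  have hqt (s : ℝ) :=
    ((hexp s).mul (((hlt s).mul (hBt 1 s)).add (hBt 0 s))).const_mul (lam / (2 * c))
  have hqx (y : ℝ) := ((((hlx y).mul (hBx 1 y)).add (hBx 0 y)).const_mul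
    (Real.exp (-(lam * t)))).const_mul (lam / (2 * c))
  have hdt : deriv (fun u => q x u) = _ := funext fun s => (hqt s).deriv
  have hdx : deriv (fun z => q z t) = _ := funext fun y => (hqx y).deriv
  have het : (fun u => pminus lam c x u) =ᶠ[nhds t] fun u => q x u := by
    filter_upwards [(isOpen_lt continuous_const (continuous_const.mul continuous_id)).mem_nhds hxt]
      with u hu using pminus_eq_besselEntire hu
  have hex : (fun z => pminus lam c z t) =ᶠ[nhds x] fun z => q z t := by
    filter_upwards [(isOpen_lt continuous_abs continuous_const).mem_nhds hxt]
      with u hu using pminus_eq_besselEntire hu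
  have hqtt := (((hexp t).mul_const (-(lam * 1))).mul (((hlt t).mul (hBt 1 t)).add (hBt 0 t))).add
    ((hexp t).mul ((((hBt 1 t).const_mul (lam / (2 * c) * (c * 1))).add
      ((hlt t).mul ((hBt 2 t).mul (hid t (lam ^ 2 / 2))))).add
        ((hBt 1 t).mul (hid t (lam ^ 2 / 2))))) |>.const_mul (lam / (2 * c))
  have hqxx := (((((hBx 1 x).const_mul (lam / (2 * c) * -1)).add
      ((hlx x).mul ((hBx 2 x).mul (hid x (-(lam ^ 2 / (2 * c ^ 2))))))).add
        ((hBx 1 x).mul (hid x (-(lam ^ 2 / (2 * c ^ 2)))))).const_mul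
    (Real.exp (-(lam * t)))).const_mul (lam / (2 * c))
  have htt := (congrFun (congrArg deriv hdt) t).trans hqtt.deriv
  have hxx := (congrFun (congrArg deriv hdx) x).trans hqxx.deriv
  have hr0 : B 0 x t = B 1 x t + pminusArg lam c x t * B 2 x t := by
    simpa using besselEntire_recurrence 0 (pminusArg lam c x t)
  have hr1 : B 1 x t = (1 + 1) * B 2 x t + pminusArg lam c x t * B 3 x t := by
    simpa using besselEntire_recurrence 1 (pminusArg lam c x t)
  rw [het.deriv.deriv_eq, het.deriv_eq, hex.deriv.deriv_eq, htt, hxx, congrFun hdt t]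
  simp only [Pi.mul_apply, Pi.add_apply, Nat.reduceAdd]
  generalize B 0 x t = b0 at *
  generalize B 1 x t = b1 at *
  generalize B 2 x t = b2 at *
  generalize B 3 x t = b3 at *
  rw [hr0, hr1, pminusArg]
  field_simp
  ring
end

section
/- Let c > 0, t > 0, p > 0 and k ∈ ℕ₀. Then ∫₀^{ct} x^p · ( (ct+(2k+1)x)(c²t²−x²)^{k} ) / ( (ct)^{2k+1}(ct+x) ) dx = (ct)^p · k! · ( Γ(p/2+1)/Γ(p/2+1+k) − (p/2)Γ((p+1)/2)/Γ((p+1)/2+1+k) ). (The integrand is the density of the telegraph meander at its end time t conditioned on an odd number N(t)=2k+1 of Poisson events.) -/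
open Real intervalIntegral

lemma intervalIntegrable_rpow_mul_sq_sub_sq_pow {q : ℝ} (hq : 0 ≤ q) (a b d : ℝ) (k : ℕ) :
    IntervalIntegrable (fun x : ℝ => x ^ q * (a ^ 2 - x ^ 2) ^ k) MeasureTheory.volume b d :=
  ((continuous_rpow_const hq).mul (by fun_prop)).intervalIntegrable _ _

/-- The recurrence obtained by integrating the derivative of
`x ^ (q + 1) * (a ^ 2 - x ^ 2) ^ (k + 1)` over `[0, a]`. -/
lemma integral_rpow_mul_sq_sub_sq_pow_succ {q : ℝ} (hq : 0 ≤ q) (a : ℝ) (k : ℕ) :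
    (q + 1) * ∫ x in (0:ℝ)..a, x ^ q * (a ^ 2 - x ^ 2) ^ (k + 1) =
      2 * (k + 1) * ∫ x in (0:ℝ)..a, x ^ (q + 2) * (a ^ 2 - x ^ 2) ^ k := by
  have hderiv (x : ℝ) (_ : x ∈ Set.uIcc 0 a) :
      HasDerivAt (fun x : ℝ => x ^ (q + 1) * (a ^ 2 - x ^ 2) ^ (k + 1))
        ((q + 1) * (x ^ q * (a ^ 2 - x ^ 2) ^ (k + 1)) -
          2 * (k + 1) * (x ^ (q + 1) * x * (a ^ 2 - x ^ 2) ^ k)) x := by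
    have h₁ := hasDerivAt_rpow_const (x := x) (p := q + 1) (Or.inr (by linarith))
    have h₂ := (((hasDerivAt_id x).pow 2).const_sub (a ^ 2)).pow (k + 1)
    refine (h₁.mul h₂).congr_deriv ?_
    simp
    ring
  have hint₁ := (intervalIntegrable_rpow_mul_sq_sub_sq_pow hq a 0 a (k + 1)).const_mul (q + 1)
  have hint₂ : IntervalIntegrable
      (fun x : ℝ => 2 * (k + 1) * (x ^ (q + 1) * x * (a ^ 2 - x ^ 2) ^ k))
      MeasureTheory.volume 0 a :=
    (continuous_const.mul (((continuous_rpow_const (by linarith)).mul continuous_id).mul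
      (by fun_prop))).intervalIntegrable _ _
  have h := integral_eq_sub_of_hasDerivAt hderiv (hint₁.sub hint₂)
  rw [integral_sub hint₁ hint₂, integral_const_mul, integral_const_mul] at h
  have hpow (x : ℝ) : x ^ (q + 1) * x = x ^ (q + 2) := by
    rw [show q + 2 = q + 1 + ((1 : ℕ) : ℝ) by push_cast; ring]
    rcases eq_or_ne x 0 with rfl | hx
    · rw [mul_zero, zero_rpow (by push_cast; linarith)]
    · rw [rpow_add_natCast hx, pow_one]
  simp only [hpow, sub_self, zero_rpow (by linarith : q + 1 ≠ 0), zero_mul, zero_pow k.succ_ne_zero,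
    mul_zero] at h
  linarith

lemma integral_rpow_mul_sq_sub_sq_pow {a : ℝ} (ha : 0 < a) (k : ℕ) {q : ℝ} (hq : 0 ≤ q) :
    ∫ x in (0:ℝ)..a, x ^ q * (a ^ 2 - x ^ 2) ^ k =
      a ^ (q + 1) * a ^ (2 * k) * k.factorial / 2 *
        (Gamma ((q + 1) / 2) / Gamma ((q + 1) / 2 + 1 + k)) := by
  induction k generalizing q with
  | zero =>
    have hG : Gamma ((q + 1) / 2) ≠ 0 := (Gamma_pos_of_pos (by linarith)).ne'
    have hq1 : q + 1 ≠ 0 := by linarith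
    simp only [pow_zero, mul_one, Nat.cast_zero, add_zero, mul_zero, Nat.factorial_zero,
      Nat.cast_one]
    rw [integral_rpow (Or.inl (by linarith)), zero_rpow hq1,
      Gamma_add_one (s := (q + 1) / 2) (by positivity)]
    field_simp
    ring
  | succ k ih =>
    have hq1 : q + 1 ≠ 0 := by linarith
    have h := integral_rpow_mul_sq_sub_sq_pow_succ hq a k
    rw [ih (by linarith), show (q + 2 + 1) / 2 = (q + 1) / 2 + 1 by ring,
      Gamma_add_one (s := (q + 1) / 2) (by positivity),
      show q + 2 + 1 = q + 1 + ((2 : ℕ) : ℝ) by push_cast; ring, rpow_add_natCast ha.ne'] at h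
    rw [← mul_right_inj' hq1, h, Nat.factorial_succ,
      show (q + 1) / 2 + 1 + ((k + 1 : ℕ) : ℝ) = (q + 1) / 2 + 1 + 1 + k by push_cast; ring]
    push_cast
    ring

theorem stmt_17 (c t p : ℝ) (k : ℕ) (hc : 0 < c) (ht : 0 < t) (hp : 0 < p) :
    ∫ x in (0:ℝ)..(c * t),
        x ^ p * ((c * t + (2 * k + 1) * x) * (c ^ 2 * t ^ 2 - x ^ 2) ^ k /
          ((c * t) ^ (2 * k + 1) * (c * t + x)))
      = (c * t) ^ p * (k.factorial : ℝ) *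
          (Real.Gamma (p / 2 + 1) / Real.Gamma (p / 2 + 1 + k)
            - p / 2 * Real.Gamma ((p + 1) / 2) / Real.Gamma ((p + 1) / 2 + 1 + k)) := by
  have ha : 0 < c * t := mul_pos hc ht
  rw [← mul_pow]
  generalize c * t = a at ha ⊢
  cases k with
  | zero =>
    have hG : Gamma ((p + 1) / 2) ≠ 0 := (Gamma_pos_of_pos (by linarith)).ne'
    have hG' : Gamma (p / 2 + 1) ≠ 0 := (Gamma_pos_of_pos (by linarith)).ne'
    have hcongr : ∀ x ∈ Set.uIcc 0 a, x ^ p * ((a + (2 * ((0 : ℕ) : ℝ) + 1) * x) *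
        (a ^ 2 - x ^ 2) ^ 0 / (a ^ (2 * 0 + 1) * (a + x))) = x ^ p * a⁻¹ := by
      intro x hx
      rw [Set.uIcc_of_le ha.le] at hx
      have hax : a + x ≠ 0 := by linarith [hx.1]
      simp only [Nat.cast_zero]
      field_simp
      ring
    rw [integral_congr hcongr, integral_mul_const, integral_rpow (Or.inl (by linarith)),
      zero_rpow (by linarith), rpow_add_one ha.ne', Nat.cast_zero, add_zero, add_zero,
      Gamma_add_one (s := (p + 1) / 2) (by positivity), Nat.factorial_zero]
    field_simp
    ring
  | succ m =>
    have hcongr : ∀ x ∈ Set.uIcc 0 a, x ^ p * ((a + (2 * ((m + 1 : ℕ) : ℝ) + 1) * x) *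
        (a ^ 2 - x ^ 2) ^ (m + 1) / (a ^ (2 * (m + 1) + 1) * (a + x))) =
        (a ^ (2 * (m + 1) + 1))⁻¹ * (x ^ p * (a ^ 2 - x ^ 2) ^ (m + 1) +
          2 * (m + 1) * a * (x ^ (p + 1) * (a ^ 2 - x ^ 2) ^ m) -
          2 * (m + 1) * (x ^ (p + 2) * (a ^ 2 - x ^ 2) ^ m)) := by
      intro x hx
      rw [Set.uIcc_of_le ha.le] at hx
      have hax : a + x ≠ 0 := by linarith [hx.1]
      have h₁ : x ^ (p + 1) = x ^ p * x := rpow_add_one' hx.1 (by linarith)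
      have h₂ : x ^ (p + 2) = x ^ p * x ^ 2 := by
        rw [show p + 2 = p + 1 + 1 by ring, rpow_add_one' hx.1 (by linarith), h₁]
        ring
      rw [h₁, h₂, pow_succ (a ^ 2 - x ^ 2) m]
      generalize (a ^ 2 - x ^ 2) ^ m = y
      push_cast
      field_simp
      ring
    have hint₀ := intervalIntegrable_rpow_mul_sq_sub_sq_pow hp.le a 0 a (m + 1)
    have hint₁ := (intervalIntegrable_rpow_mul_sq_sub_sq_pow
      (by linarith : 0 ≤ p + 1) a 0 a m).const_mul (2 * (m + 1) * a)
    have hint₂ := (intervalIntegrable_rpow_mul_sq_sub_sq_pow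
      (by linarith : 0 ≤ p + 2) a 0 a m).const_mul (2 * (m + 1))
    rw [integral_congr hcongr, integral_const_mul, integral_sub (hint₀.add hint₁) hint₂,
      integral_add hint₀ hint₁, integral_const_mul, integral_const_mul,
      ← integral_rpow_mul_sq_sub_sq_pow_succ hp.le, integral_rpow_mul_sq_sub_sq_pow ha _ hp.le,
      integral_rpow_mul_sq_sub_sq_pow ha _ (by linarith : 0 ≤ p + 1),
      show (p + 1 + 1) / 2 = p / 2 + 1 by ring,
      show p / 2 + 1 + 1 + (m : ℝ) = p / 2 + 1 + ((m + 1 : ℕ) : ℝ) by push_cast; ring,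
      rpow_add_one ha.ne', rpow_add_one ha.ne', rpow_add_one ha.ne', Nat.factorial_succ]
    generalize Gamma (p / 2 + 1) / Gamma (p / 2 + 1 + ((m + 1 : ℕ) : ℝ)) = u
    rw [mul_div_assoc (p / 2)]
    generalize Gamma ((p + 1) / 2) / Gamma ((p + 1) / 2 + 1 + ((m + 1 : ℕ) : ℝ)) = v
    push_cast
    field_simp
    ring
end
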